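/- arXiv:1908.01649 — 2 statements merged into one kernel-verified Lean document; each statement's English description precedes it below -/
import Mathlib

section
/- Let G be a finite 2-generated group, let N be an abelian minimal normal subgroup of G, and let g1, g2 be elements of G with ⟨g1, g2⟩N = G. Then |Φ_N(g1,g2)| = |N| if and only if |N| = 2, N has a complement in G, and the quotient G/N has an epimorphic image of order 2. -/
theorem aux_proj {G : Type*} [Group G] (N : Subgroup G) [N.Normal] (H : Subgroup G)
    (h1 : H ⊓ N = ⊥) (h2 : H ⊔ N = ⊤) :
    ∃ π : G →* G, (∀ g, π g ∈ H) ∧ (∀ g, (π g)⁻¹ * g ∈ N) ∧ (∀ h ∈ H, π h = h) ∧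
      (∀ n ∈ N, π n = 1) := by
  have hb : Function.Bijective ((QuotientGroup.mk' N).comp H.subtype) := by
    constructor
    · rw [injective_iff_map_eq_one]
      intro a ha
      have : (a : G) ∈ H ⊓ N := ⟨a.2, by
        simpa [QuotientGroup.eq_one_iff] using ha⟩
      rw [h1, Subgroup.mem_bot] at this
      exact Subtype.ext this
    · intro x
      obtain ⟨g, rfl⟩ := QuotientGroup.mk_surjective x
      have : g ∈ H ⊔ N := h2 ▸ Subgroup.mem_top g
      obtain ⟨y, hy, z, hz, rfl⟩ := Subgroup.mem_sup_of_normal_right.1 this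
      refine ⟨⟨y, hy⟩, ?_⟩
      simp only [MonoidHom.comp_apply, Subgroup.subtype_apply, QuotientGroup.mk'_apply]
      rw [QuotientGroup.eq]
      simpa using hz
  let e := MulEquiv.ofBijective _ hb
  let π : G →* G := H.subtype.comp (e.symm.toMonoidHom.comp (QuotientGroup.mk' N))
  have hπ1 : ∀ g, π g ∈ H := fun g => (e.symm (QuotientGroup.mk' N g)).2
  have hπ2 : ∀ g, (π g)⁻¹ * g ∈ N := by
    intro g
    rw [← QuotientGroup.eq]
    exact e.apply_symm_apply (QuotientGroup.mk' N g)
  refine ⟨π, hπ1, hπ2, ?_, ?_⟩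
  · intro h hh
    have : (π h)⁻¹ * h ∈ H ⊓ N := ⟨H.mul_mem (H.inv_mem (hπ1 h)) hh, hπ2 h⟩
    rw [h1, Subgroup.mem_bot, inv_mul_eq_one] at this
    exact this
  · intro n hn
    have : π n ∈ H ⊓ N := ⟨hπ1 n, by
      have := N.mul_mem hn (N.inv_mem (hπ2 n))
      simpa using this⟩
    rwa [h1, Subgroup.mem_bot] at this

theorem aux_sup {G : Type*} [Group G] (N : Subgroup G) (g1 g2 : G)
    (hgen : Subgroup.closure {g1, g2} ⊔ N = ⊤) (n1 n2 : G) (h1 : n1 ∈ N) (h2 : n2 ∈ N) :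
    Subgroup.closure {g1 * n1, g2 * n2} ⊔ N = ⊤ := by
  rw [eq_top_iff, ← hgen]
  refine sup_le ?_ le_sup_right
  rw [Subgroup.closure_le]
  have key : ∀ g n : G, n ∈ N → g * n ∈ Subgroup.closure {g1 * n1, g2 * n2} →
      g ∈ Subgroup.closure {g1 * n1, g2 * n2} ⊔ N := by
    intro g n hn hg
    have := Subgroup.mul_mem _ ((le_sup_left : _ ≤ Subgroup.closure {g1 * n1, g2 * n2} ⊔ N) hg)
      ((le_sup_right : N ≤ Subgroup.closure {g1 * n1, g2 * n2} ⊔ N) (N.inv_mem hn))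
    simpa using this
  rintro x (rfl | rfl)
  · exact key _ n1 h1 (Subgroup.subset_closure (by simp))
  · exact key _ n2 h2 (Subgroup.subset_closure (by simp))

theorem aux_inf {G : Type*} [Group G] (N : Subgroup G) [N.Normal]
    (hmin : ∀ M : Subgroup G, M.Normal → M ≤ N → M ≠ ⊥ → M = N)
    (hab : ∀ x ∈ N, ∀ y ∈ N, x * y = y * x) (K : Subgroup G)
    (hK : K ⊔ N = ⊤) (hne : K ≠ ⊤) : K ⊓ N = ⊥ := by
  by_contra hbot
  have hnor : (K ⊓ N).Normal := by
    constructor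
    intro x hx g
    have : g ∈ K ⊔ N := hK ▸ Subgroup.mem_top g
    obtain ⟨y, hy, z, hz, rfl⟩ := Subgroup.mem_sup_of_normal_right.1 this
    have e : y * z * x * (y * z)⁻¹ = y * x * y⁻¹ := by
      have := hab z hz x hx.2
      calc y * z * x * (y * z)⁻¹ = y * (z * x) * z⁻¹ * y⁻¹ := by group
        _ = _ := by rw [this]; group
    rw [e]
    exact ⟨K.mul_mem (K.mul_mem hy hx.1) (K.inv_mem hy),
      Subgroup.Normal.conj_mem ‹_› x hx.2 y⟩
  have h := hmin _ hnor inf_le_right hbot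
  have : N ≤ K := inf_eq_right.1 h
  rw [sup_eq_left.2 this] at hK
  exact hne hK

/-- the subgroup of pairs realised by automorphisms trivial on `N` and `G/N` -/
def auxT {G : Type*} [Group G] (N : Subgroup G) (h1 h2 : G) : Subgroup (G × G) where
  carrier := {q | ∃ θ : MulAut G, (∀ n ∈ N, θ n = n) ∧ (∀ g, g⁻¹ * θ g ∈ N) ∧
    θ h1 = h1 * q.1 ∧ θ h2 = h2 * q.2}
  one_mem' := ⟨1, by simp [N.one_mem]⟩
  mul_mem' := by
    rintro ⟨a1, a2⟩ ⟨b1, b2⟩ ⟨θ, p1, p2, p3, p4⟩ ⟨η, r1, r2, r3, r4⟩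
    simp only at p3 p4 r3 r4
    have hb1 : b1 ∈ N := by simpa [r3] using r2 h1
    have hb2 : b2 ∈ N := by simpa [r4] using r2 h2
    refine ⟨θ * η, fun n hn => by simp [r1 n hn, p1 n hn], fun g => ?_, ?_, ?_⟩
    · have : g⁻¹ * (θ * η) g = g⁻¹ * θ g * (g⁻¹ * η g) := by
        have := p1 _ (r2 g)
        rw [map_mul, map_inv, inv_mul_eq_iff_eq_mul] at this
        simp only [MulAut.mul_apply, this]
        group
      rw [this]
      exact N.mul_mem (p2 g) (r2 g)
    · simp [r3, p3, p1 b1 hb1, mul_assoc]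
    · simp [r4, p4, p1 b2 hb2, mul_assoc]
  inv_mem' := by
    rintro ⟨a1, a2⟩ ⟨θ, p1, p2, p3, p4⟩
    simp only at p3 p4
    have hb1 : a1 ∈ N := by simpa [p3] using p2 h1
    have hb2 : a2 ∈ N := by simpa [p4] using p2 h2
    refine ⟨θ⁻¹, fun n hn => ?_, fun g => ?_, ?_, ?_⟩
    · apply θ.injective
      simp [p1 n hn]
    · obtain ⟨k, rfl⟩ := θ.surjective g
      have := N.inv_mem (p2 k)
      simpa using this
    · apply θ.injective
      simp [p3, p1 _ (N.inv_mem hb1)]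
    · apply θ.injective
      simp [p4, p1 _ (N.inv_mem hb2)]

theorem auxT_le {G : Type*} [Group G] (N : Subgroup G) (h1 h2 : G) :
    auxT N h1 h2 ≤ N.prod N := by
  rintro ⟨a1, a2⟩ ⟨θ, p1, p2, p3, p4⟩
  exact ⟨by simpa [p3] using p2 h1, by simpa [p4] using p2 h2⟩

theorem aux_mulAut {G : Type*} [Group G] [Finite G] (N : Subgroup G)
    (θ : G →* G) (p1 : ∀ n ∈ N, θ n = n) (p2 : ∀ g, g⁻¹ * θ g ∈ N) :
    ∃ η : MulAut G, ∀ g, η g = θ g := by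
  have hi : Function.Injective θ := by
    rw [injective_iff_map_eq_one]
    intro a ha
    have := p2 a
    rw [ha, mul_one] at this
    have h2 := p1 a (by simpa using N.inv_mem this)
    rw [← h2, ha]
  exact ⟨MulEquiv.ofBijective θ ⟨hi, Finite.surjective_of_injective hi⟩, fun g => rfl⟩

theorem auxT_mem {G : Type*} [Group G] [Finite G] (N : Subgroup G) [N.Normal]
    (hNne : N ≠ ⊥)
    (hmin : ∀ M : Subgroup G, M.Normal → M ≤ N → M ≠ ⊥ → M = N)
    (hab : ∀ x ∈ N, ∀ y ∈ N, x * y = y * x)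
    (h1 h2 : G) (hgen : Subgroup.closure {h1, h2} ⊔ N = ⊤)
    (hH : Subgroup.closure {h1, h2} ⊓ N = ⊥) (q : G × G) (hq : q ∈ N.prod N) :
    q ∈ auxT N h1 h2 ↔ Subgroup.closure {h1 * q.1, h2 * q.2} ≠ ⊤ := by
  obtain ⟨n1, n2⟩ := q
  obtain ⟨hn1, hn2⟩ := hq
  simp only at hn1 hn2
  constructor
  · rintro ⟨θ, p1, p2, p3, p4⟩ htop
    simp only at htop p3 p4
    have e : (Subgroup.closure {h1, h2}).map θ.toMonoidHom = ⊤ := by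
      rw [MonoidHom.map_closure, ← htop]
      simp [Set.image_pair, p3, p4]
    apply hNne
    rw [← hH, eq_comm, inf_eq_right]
    intro n hn
    have : n ∈ (Subgroup.closure {h1, h2}).map θ.toMonoidHom := e ▸ Subgroup.mem_top n
    obtain ⟨k, hk, hkn⟩ := this
    have : θ k = θ n := by rw [p1 n hn]; exact hkn
    rwa [← θ.injective this]
  · intro hne
    simp only at hne
    have hs := aux_sup N h1 h2 hgen n1 n2 hn1 hn2
    have hi := aux_inf N hmin hab _ hs hne
    obtain ⟨x, x1, x2, x3, x4⟩ := aux_proj N _ hi hs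
    obtain ⟨y, y1, y2, y3, y4⟩ := aux_proj N _ hH hgen
    have hxy : ∀ g, x g * (y g)⁻¹ ∈ N := by
      intro g
      have a1 : x g * ((x g)⁻¹ * g) * (x g)⁻¹ ∈ N :=
        Subgroup.Normal.conj_mem ‹_› _ (x2 g) _
      have a2 : y g * ((y g)⁻¹ * g) * (y g)⁻¹ ∈ N :=
        Subgroup.Normal.conj_mem ‹_› _ (y2 g) _
      have := N.mul_mem (N.inv_mem a1) a2
      simpa [mul_assoc] using this
    let θ : G →* G := MonoidHom.mk' (fun g => x g * (y g)⁻¹ * g) (by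
      intro a b
      have := hab _ (hxy b) _ (y2 a)
      calc x (a * b) * (y (a * b))⁻¹ * (a * b)
          = x a * ((x b * (y b)⁻¹) * ((y a)⁻¹ * a)) * b := by
            simp only [map_mul]; group
        _ = _ := by rw [this]; group)
    have hθ : ∀ g, θ g = x g * (y g)⁻¹ * g := fun g => rfl
    have p1 : ∀ n ∈ N, θ n = n := by
      intro n hn; simp [hθ, x4 n hn, y4 n hn]
    have p2 : ∀ g, g⁻¹ * θ g ∈ N := by
      intro g
      have := Subgroup.Normal.conj_mem ‹_› _ (hxy g) g⁻¹
      simpa [hθ, mul_assoc] using this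
    obtain ⟨η, hη⟩ := aux_mulAut N θ p1 p2
    have key : ∀ h n : G, n ∈ N → h * n ∈ Subgroup.closure {h1 * n1, h2 * n2} →
        h ∈ Subgroup.closure {h1, h2} → θ h = h * n := by
      intro h n hn a b
      have e1 := x3 _ a
      rw [map_mul, x4 n hn, mul_one] at e1
      rw [hθ, e1, y3 _ b]
      group
    refine ⟨η, fun n hn => by rw [hη, p1 n hn], fun g => by rw [hη]; exact p2 g, ?_, ?_⟩
    · rw [hη]
      exact key _ _ hn1 (Subgroup.subset_closure (by simp)) (Subgroup.subset_closure (by simp))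
    · rw [hη]
      exact key _ _ hn2 (Subgroup.subset_closure (by simp)) (Subgroup.subset_closure (by simp))

/-- the set `Φ_N(g1, g2)` -/
def auxPhi {G : Type*} [Group G] (N : Subgroup G) (g1 g2 : G) : Set (G × G) :=
  {q : G × G | q.1 ∈ N ∧ q.2 ∈ N ∧ Subgroup.closure {g1 * q.1, g2 * q.2} = ⊤}

theorem auxPhi_shift {G : Type*} [Group G] (N : Subgroup G) (g1 g2 n1 n2 : G)
    (hn1 : n1 ∈ N) (hn2 : n2 ∈ N) :
    Nat.card (auxPhi N (g1 * n1) (g2 * n2)) = Nat.card (auxPhi N g1 g2) := by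
  refine Nat.card_congr ((Equiv.mulLeft ((n1, n2) : G × G)).subtypeEquiv ?_)
  rintro ⟨a, b⟩
  simp only [auxPhi, Set.mem_ofPred_eq, Equiv.coe_mulLeft, Prod.mk_mul_mk, mul_assoc,
    N.mul_mem_cancel_left hn1, N.mul_mem_cancel_left hn2]

theorem aux_count {G : Type*} [Group G] [Finite G] (N : Subgroup G) [N.Normal]
    (hNne : N ≠ ⊥)
    (hmin : ∀ M : Subgroup G, M.Normal → M ≤ N → M ≠ ⊥ → M = N)
    (hab : ∀ x ∈ N, ∀ y ∈ N, x * y = y * x)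
    (h1 h2 : G) (hgen : Subgroup.closure {h1, h2} ⊔ N = ⊤)
    (hH : Subgroup.closure {h1, h2} ⊓ N = ⊥) :
    Nat.card (auxPhi N h1 h2) + Nat.card (auxT N h1 h2) = Nat.card N * Nat.card N := by
  have e : auxPhi N h1 h2 = (N.prod N : Set (G × G)) \ (auxT N h1 h2 : Set (G × G)) := by
    ext q
    constructor
    · rintro ⟨a, b, c⟩
      refine ⟨⟨a, b⟩, fun h => ?_⟩
      exact (auxT_mem N hNne hmin hab h1 h2 hgen hH q ⟨a, b⟩).1 h c
    · rintro ⟨⟨a, b⟩, c⟩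
      refine ⟨a, b, ?_⟩
      by_contra h
      exact c ((auxT_mem N hNne hmin hab h1 h2 hgen hH q ⟨a, b⟩).2 h)
  have := Set.ncard_sdiff_add_ncard_of_subset (s := (auxT N h1 h2 : Set (G × G)))
    (t := (N.prod N : Set (G × G))) (auxT_le N h1 h2)
  rw [← e] at this
  have e2 : (N.prod N : Set (G × G)).ncard = Nat.card N * Nat.card N := by
    rw [← Nat.card_prod, ← Nat.card_coe_set_eq]
    exact Nat.card_congr (N.prodEquiv N).toEquiv
  rw [e2] at this
  exact this

/-- the homomorphism to a central `N` from an automorphism -/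
theorem aux_chi {G : Type*} [Group G] (N : Subgroup G) (hc : ∀ n ∈ N, ∀ g : G, n * g = g * n)
    (θ : G →* G) (p2 : ∀ g, (θ g)⁻¹ * g ∈ N) :
    ∃ χ : G →* N, ∀ g, (χ g : G) = (θ g)⁻¹ * g := by
  refine ⟨MonoidHom.mk' (fun g => ⟨(θ g)⁻¹ * g, p2 g⟩) ?_, fun g => rfl⟩
  intro a b
  apply Subtype.ext
  simp only [map_mul, Subgroup.coe_mul]
  have := hc _ (p2 a) (θ b)⁻¹
  calc (θ a * θ b)⁻¹ * (a * b) = (θ b)⁻¹ * ((θ a)⁻¹ * a) * b := by group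
    _ = _ := by rw [← this]; group

theorem aux_central {G : Type*} [Group G] (N : Subgroup G) [N.Normal] (h : Nat.card N = 2) :
    ∀ n ∈ N, ∀ g : G, n * g = g * n := by
  intro n hn g
  have hu : ∀ a b : N, a ≠ 1 → b ≠ 1 → a = b := by
    obtain ⟨x, y, hxy, huniv⟩ := Nat.card_eq_two_iff.1 h
    intro a b ha hb
    have h1 : (1 : N) ∈ ({x, y} : Set N) := huniv ▸ Set.mem_univ _
    have h2 : a ∈ ({x, y} : Set N) := huniv ▸ Set.mem_univ _
    have h3 : b ∈ ({x, y} : Set N) := huniv ▸ Set.mem_univ _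
    simp only [Set.mem_insert_iff, Set.mem_singleton_iff] at h1 h2 h3
    grind
  by_cases h1 : n = 1
  · simp [h1]
  · have := hu ⟨n, hn⟩ ⟨g * n * g⁻¹, Subgroup.Normal.conj_mem ‹_› _ hn _⟩
      (by simpa [Subtype.ext_iff] using h1) (by simpa [Subtype.ext_iff] using h1)
    have := congrArg Subtype.val this
    simp only at this
    rw [eq_mul_inv_iff_mul_eq] at this
    exact this

theorem aux_iso {N : Type*} [Group N] (h : Nat.card N = 2) :
    Nonempty (N ≃* Multiplicative (ZMod 2)) := by
  have : Fact (Nat.Prime 2) := ⟨Nat.prime_two⟩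
  exact ⟨mulEquivOfPrimeCardEq (p := 2) h (by simp)⟩

theorem aux_surj (Q : Type*) [Group Q] (f : Q →* Multiplicative (ZMod 2)) (x : Q)
    (hx : f x ≠ 1) : Function.Surjective f := by
  intro y
  have : ∀ a b : Multiplicative (ZMod 2), a ≠ 1 → b = 1 ∨ b = a := by decide
  rcases this (f x) y hx with h | h
  · exact ⟨1, by simp [h]⟩
  · exact ⟨x, h.symm⟩

theorem aux_two {G : Type*} [Group G] [Finite G]
    (h2gen : ∃ a b : G, Subgroup.closure {a, b} = ⊤)
    (N : Subgroup G) [N.Normal]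
    (h1 h2 : G) (hgen : Subgroup.closure {h1, h2} ⊔ N = ⊤)
    (hH : Subgroup.closure {h1, h2} ⊓ N = ⊥) (hN : Nat.card N = 2) :
    Nat.card (auxT N h1 h2) = 2 ↔
      ∃ f : G ⧸ N →* Multiplicative (ZMod 2), Function.Surjective f := by
  have hc := aux_central N hN
  obtain ⟨e⟩ := aux_iso hN
  have hex : ∀ q ∈ auxT N h1 h2, ∃ χ : G →* N, (∀ n ∈ N, χ n = 1) ∧
      (χ h1 : G) = q.1⁻¹ ∧ (χ h2 : G) = q.2⁻¹ := by
    rintro q ⟨θ, p1, p2, p3, p4⟩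
    obtain ⟨χ, hχ⟩ := aux_chi N hc θ.toMonoidHom (fun g => by
      simpa using N.inv_mem (p2 g))
    have hχ' : ∀ g, (χ g : G) = (θ g)⁻¹ * g := hχ
    refine ⟨χ, fun n hn => Subtype.ext ?_, ?_, ?_⟩
    · simp [hχ', p1 n hn]
    · simp [hχ', p3]
    · simp [hχ', p4]
  constructor
  · intro hT
    have : Nontrivial (auxT N h1 h2) := Finite.one_lt_card_iff_nontrivial.1 (by omega)
    obtain ⟨⟨q, hq⟩, hq1⟩ := exists_ne (1 : auxT N h1 h2)
    obtain ⟨χ, c1, c2, c3⟩ := hex q hq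
    let f : G ⧸ N →* Multiplicative (ZMod 2) :=
      QuotientGroup.lift N (e.toMonoidHom.comp χ) (by
        intro n hn
        simp [c1 n hn])
    have hf : ∀ g : G, f (g : G ⧸ N) = e (χ g) := fun g => rfl
    have hor : q.1 ≠ 1 ∨ q.2 ≠ 1 := by
      by_contra hcon
      push Not at hcon
      exact hq1 (Subtype.ext (Prod.ext hcon.1 hcon.2))
    refine ⟨f, ?_⟩
    rcases hor with h | h
    · apply aux_surj _ f (h1 : G ⧸ N)
      rw [hf]
      intro hh
      rw [EmbeddingLike.map_eq_one_iff] at hh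
      rw [hh] at c2
      apply h
      simpa [eq_comm] using c2
    · apply aux_surj _ f (h2 : G ⧸ N)
      rw [hf]
      intro hh
      rw [EmbeddingLike.map_eq_one_iff] at hh
      rw [hh] at c3
      apply h
      simpa [eq_comm] using c3
  · rintro ⟨f, hf⟩
    have hdvd : Nat.card (auxT N h1 h2) ∣ 4 := by
      have := Subgroup.card_dvd_of_le (auxT_le N h1 h2)
      rwa [Nat.card_congr (N.prodEquiv N).toEquiv, Nat.card_prod, hN] at this
    have hne1 : Nat.card (auxT N h1 h2) ≠ 1 := by
      intro hT
      rw [Subgroup.card_eq_one] at hT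
      let ψ : G →* N := (e.symm.toMonoidHom.comp f).comp (QuotientGroup.mk' N)
      have hψ : ∀ g : G, ψ g = e.symm (f (g : G ⧸ N)) := fun g => rfl
      have hψN : ∀ n ∈ N, ψ n = 1 := by
        intro n hn
        rw [hψ, (QuotientGroup.eq_one_iff n).2 hn]
        simp
      let θ : G →* G := MonoidHom.mk' (fun g => g * ψ g) (by
        intro a b
        have := hc _ (ψ a).2 b
        calc a * b * (ψ (a * b) : G) = a * (b * (ψ a : G)) * (ψ b : G) := by
              simp [mul_assoc]
          _ = _ := by rw [← this]; group)
      have hθ : ∀ g, θ g = g * ψ g := fun g => rfl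
      have p1 : ∀ n ∈ N, θ n = n := by
        intro n hn
        simp [hθ, hψN n hn]
      have p2 : ∀ g, g⁻¹ * θ g ∈ N := by
        intro g
        simp [hθ]
      obtain ⟨η, hη⟩ := aux_mulAut N θ p1 p2
      have hmem : ((ψ h1 : G), (ψ h2 : G)) ∈ auxT N h1 h2 :=
        ⟨η, fun n hn => by rw [hη, p1 n hn], fun g => by rw [hη]; exact p2 g,
          by rw [hη, hθ], by rw [hη, hθ]⟩
      rw [hT, Subgroup.mem_bot, Prod.ext_iff] at hmem
      have hker : ψ.ker = ⊤ := by
        rw [eq_top_iff, ← hgen]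
        refine sup_le ?_ (fun n hn => hψN n hn)
        rw [Subgroup.closure_le]
        rintro x (rfl | rfl)
        · exact Subtype.ext hmem.1
        · exact Subtype.ext hmem.2
      obtain ⟨x, hx⟩ := hf (Multiplicative.ofAdd 1)
      obtain ⟨g, rfl⟩ := QuotientGroup.mk_surjective x
      have hg : g ∈ ψ.ker := hker ▸ Subgroup.mem_top g
      rw [MonoidHom.mem_ker, hψ, EmbeddingLike.map_eq_one_iff, hx] at hg
      revert hg
      decide
    have hne4 : Nat.card (auxT N h1 h2) ≠ 4 := by
      intro hT
      obtain ⟨y, y1, y2, y3, y4⟩ := aux_proj N _ hH hgen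
      obtain ⟨π, hπ⟩ := aux_chi N hc y y2
      choose χ c1 c2 c3 using hex
      obtain ⟨a, b, hab⟩ := h2gen
      let F : Option (auxT N h1 h2) → (G →* N) := fun o =>
        o.elim π (fun q => χ q.1 q.2)
      obtain ⟨n0, hn0⟩ : ∃ n : N, n ≠ 1 := by
        have : Nontrivial N := Finite.one_lt_card_iff_nontrivial.1 (by omega)
        exact exists_ne 1
      have hπχ : ∀ q hq, π ≠ χ q hq := by
        intro q hq hh
        apply hn0
        apply Subtype.ext
        have e1 := hπ n0
        rw [y4 _ n0.2, hh, c1 q hq _ n0.2] at e1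
        simpa [eq_comm] using e1
      have hF : Function.Injective F := by
        rintro (_ | ⟨q, hq⟩) (_ | ⟨r, hr⟩) hqr
        · rfl
        · exact absurd hqr (hπχ r hr)
        · exact absurd hqr.symm (hπχ q hq)
        · have hqr' : χ q hq = χ r hr := hqr
          have e1 := c2 q hq
          have e2 := c3 q hq
          rw [hqr', c2 r hr, inv_inj] at e1
          rw [hqr', c3 r hr, inv_inj] at e2
          congr 2
          exact (Prod.ext e1 e2).symm
      let E : (G →* N) → N × N := fun φ => (φ a, φ b)
      have hE : Function.Injective E := by
        intro φ ψ h
        have h' := Prod.ext_iff.1 h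
        refine MonoidHom.eq_of_eqOn_dense hab ?_
        rintro x (rfl | rfl)
        · exact h'.1
        · exact h'.2
      have := Nat.card_le_card_of_injective _ (hE.comp hF)
      rw [Finite.card_option, hT, Nat.card_prod, hN] at this
      omega
    have hle := Nat.le_of_dvd (by norm_num) hdvd
    generalize Nat.card (auxT N h1 h2) = c at *
    interval_cases c <;> omega



/-- Let `G` be a finite 2-generated group, `N` an abelian minimal normal
subgroup of `G`, and `g1, g2 ∈ G` with `⟨g1, g2⟩N = G`. Then `|Φ_N(g1,g2)| = |N|` iff
`|N| = 2`, `N` has a complement in `G`, and `G/N` has an epimorphic image of order 2. -/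
theorem stmt_3 {G : Type*} [Group G] [Finite G]
    (h2gen : ∃ a b : G, Subgroup.closure {a, b} = ⊤)
    (N : Subgroup G) [N.Normal]
    (hNne : N ≠ ⊥)
    (hmin : ∀ M : Subgroup G, M.Normal → M ≤ N → M ≠ ⊥ → M = N)
    (hab : ∀ x ∈ N, ∀ y ∈ N, x * y = y * x)
    (g1 g2 : G) (hgen : Subgroup.closure {g1, g2} ⊔ N = ⊤) :
    Nat.card {q : G × G | q.1 ∈ N ∧ q.2 ∈ N ∧
        Subgroup.closure {g1 * q.1, g2 * q.2} = ⊤} = Nat.card N ↔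
      (Nat.card N = 2 ∧ (∃ H : Subgroup G, H ⊓ N = ⊥ ∧ H ⊔ N = ⊤) ∧
        ∃ f : G ⧸ N →* Multiplicative (ZMod 2), Function.Surjective f) := by

  have hN1 : 1 < Nat.card N := by
    rw [Subgroup.one_lt_card_iff_ne_bot]
    exact hNne
  change Nat.card (auxPhi N g1 g2) = _ ↔ _
  have main : ∀ n1 ∈ N, ∀ n2 ∈ N, Subgroup.closure {g1 * n1, g2 * n2} ⊓ N = ⊥ →
      (Nat.card (auxPhi N g1 g2) = Nat.card N ↔
      (Nat.card N = 2 ∧ ∃ f : G ⧸ N →* Multiplicative (ZMod 2), Function.Surjective f)) := by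
    intro n1 hn1 n2 hn2 hH
    have hs := aux_sup N g1 g2 hgen n1 n2 hn1 hn2
    have hcount := aux_count N hNne hmin hab _ _ hs hH
    rw [auxPhi_shift N g1 g2 n1 n2 hn1 hn2] at hcount
    have htwo := aux_two h2gen N _ _ hs hH
    constructor
    · intro h
      have hdvd := Subgroup.card_dvd_of_le (auxT_le N (g1 * n1) (g2 * n2))
      rw [Nat.card_congr (N.prodEquiv N).toEquiv, Nat.card_prod] at hdvd
      have h2 : Nat.card N = 2 := by
        rw [h] at hcount
        obtain ⟨m, hm⟩ : ∃ m, Nat.card N = m + 1 := ⟨Nat.card N - 1, by omega⟩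
        rw [hm] at hcount hdvd hN1 ⊢
        have hT : Nat.card (auxT N (g1 * n1) (g2 * n2)) = (m + 1) * m := by nlinarith
        rw [hT] at hdvd
        have h3 : m ∣ m + 1 := Nat.dvd_of_mul_dvd_mul_left (by omega) hdvd
        have h4 : m ∣ 1 := (Nat.dvd_add_right (dvd_refl m)).1 h3
        have := Nat.dvd_one.1 h4
        omega
      refine ⟨h2, (htwo h2).1 ?_⟩
      rw [h, h2] at hcount
      omega
    · rintro ⟨h2, hf⟩
      have := (htwo h2).2 hf
      rw [this, h2] at hcount
      omega
  constructor
  · intro h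
    have hbad : ∃ n1 ∈ N, ∃ n2 ∈ N, Subgroup.closure {g1 * n1, g2 * n2} ≠ ⊤ := by
      by_contra hcon
      push Not at hcon
      have e : auxPhi N g1 g2 = (N.prod N : Set (G × G)) := by
        ext q
        exact ⟨fun hq => ⟨hq.1, hq.2.1⟩, fun hq => ⟨hq.1, hq.2, hcon _ hq.1 _ hq.2⟩⟩
      have e2 : Nat.card (auxPhi N g1 g2) = Nat.card N * Nat.card N := by
        rw [e, ← Nat.card_prod]
        exact Nat.card_congr (N.prodEquiv N).toEquiv
      rw [h] at e2
      nlinarith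
    obtain ⟨n1, hn1, n2, hn2, hne⟩ := hbad
    have hs := aux_sup N g1 g2 hgen n1 n2 hn1 hn2
    have hi := aux_inf N hmin hab _ hs hne
    obtain ⟨a, b⟩ := (main n1 hn1 n2 hn2 hi).1 h
    exact ⟨a, ⟨_, hi, hs⟩, b⟩
  · rintro ⟨h2, ⟨H, hH1, hH2⟩, hf⟩
    obtain ⟨y, y1, y2, y3, y4⟩ := aux_proj N _ hH1 hH2
    have hm : ∀ g, g⁻¹ * y g ∈ N := fun g => by simpa using N.inv_mem (y2 g)
    refine (main _ (hm g1) _ (hm g2) ?_).2 ⟨h2, hf⟩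
    rw [eq_bot_iff, ← hH1]
    refine inf_le_inf_right N ?_
    rw [Subgroup.closure_le]
    rintro x (rfl | rfl)
    · simpa using y1 g1
    · simpa using y1 g2
end

section
/- Let G be a finite 2-generated group. If the number of ordered pairs (x, y) ∈ G × G with ⟨x, y⟩ = G is strictly less than 6·|G|, then G is soluble. -/
namespace FewGen

open scoped commutatorElement

variable {G : Type*} [Group G]

/-- `x, y` generate `G`. -/
def Gen (x y : G) : Prop := Subgroup.closure {x, y} = (⊤ : Subgroup G)

theorem Gen.of_mem {x y u v : G} (h : Gen x y)
    (hx : x ∈ Subgroup.closure {u, v}) (hy : y ∈ Subgroup.closure {u, v}) : Gen u v := by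
  unfold Gen at *
  rw [eq_top_iff, ← h, Subgroup.closure_le]
  rintro z (rfl | rfl) <;> assumption

theorem mem_l (u v : G) : u ∈ Subgroup.closure {u, v} := Subgroup.subset_closure (by simp)
theorem mem_r (u v : G) : v ∈ Subgroup.closure {u, v} := Subgroup.subset_closure (by simp)

theorem Gen.swap {x y : G} (h : Gen x y) : Gen y x := h.of_mem (mem_r _ _) (mem_l _ _)

theorem Gen.top_le {x y : G} (h : Gen x y) {H : Subgroup G} (hx : x ∈ H) (hy : y ∈ H) :
    H = ⊤ := by
  unfold Gen at h
  rw [eq_top_iff, ← h, Subgroup.closure_le]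
  rintro z (rfl | rfl) <;> assumption

/-- multiplication of the second generator on the left by the first. -/
theorem Gen.mulr {x y : G} (h : Gen x y) : Gen x (x * y) := by
  refine h.of_mem (mem_l _ _) ?_
  have := mul_mem (inv_mem (mem_l x (x*y))) (mem_r x (x*y))
  simpa using this

theorem Gen.mull {x y : G} (h : Gen x y) : Gen (x * y) y := by
  refine h.of_mem ?_ (mem_r _ _)
  have := mul_mem (mem_l (x*y) y) (inv_mem (mem_r (x*y) y))
  simpa using this

theorem Gen.invl {x y : G} (h : Gen x y) : Gen x⁻¹ y := by
  refine h.of_mem ?_ (mem_r _ _)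
  simpa using inv_mem (mem_l x⁻¹ y)

theorem Gen.invr {x y : G} (h : Gen x y) : Gen x y⁻¹ := h.swap.invl.swap

/-- Conjugation by `g`. -/
def cj (g x : G) : G := g⁻¹ * x * g

theorem cj_mul (g x y : G) : cj g (x * y) = cj g x * cj g y := by simp [cj, mul_assoc]
theorem cj_inv (g x : G) : cj g x⁻¹ = (cj g x)⁻¹ := by simp [cj, mul_assoc]
theorem cj_cj (g h x : G) : cj h (cj g x) = cj (g * h) x := by simp [cj, mul_assoc]
theorem cj_one (x : G) : cj 1 x = x := by simp [cj]
theorem cj_id (g : G) : cj g 1 = 1 := by simp [cj]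
theorem cj_pow (g x : G) (n : ℕ) : cj g (x ^ n) = cj g x ^ n := by
  induction n with
  | zero => simp [cj]
  | succ n ih => rw [pow_succ, pow_succ, cj_mul, ih]
theorem cj_inj {g x y : G} : cj g x = cj g y ↔ x = y := by simp [cj]
theorem cj_eq_self {g x : G} : cj g x = x ↔ Commute g x := by
  unfold cj Commute SemiconjBy
  constructor
  · intro h; rw [mul_assoc, inv_mul_eq_iff_eq_mul] at h; exact h.symm
  · intro h; rw [mul_assoc, inv_mul_eq_iff_eq_mul]; exact h.symm

theorem Gen.conj {x y : G} (h : Gen x y) (g : G) : Gen (cj g x) (cj g y) := by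
  have : ((Subgroup.closure {cj g x, cj g y}).map (MulAut.conj g).toMonoidHom) = ⊤ := by
    apply h.top_le
    · refine ⟨cj g x, mem_l _ _, ?_⟩; simp [cj, mul_assoc]
    · refine ⟨cj g y, mem_r _ _, ?_⟩; simp [cj, mul_assoc]
  unfold Gen
  rw [eq_top_iff]
  intro z _
  have hz : g * z * g⁻¹ ∈ ((Subgroup.closure {cj g x, cj g y}).map (MulAut.conj g).toMonoidHom) := by
    rw [this]; trivial
  obtain ⟨w, hw, hwz⟩ := hz
  simp at hwz
  rwa [hwz] at hw

/-- In a centreless group, an element fixing both generators is trivial. -/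
theorem Gen.eq_one {x y g : G} (h : Gen x y) (hZ : Subgroup.center G = ⊥)
    (hx : cj g x = x) (hy : cj g y = y) : g = 1 := by
  have : Subgroup.centralizer {g} = ⊤ := by
    apply h.top_le
    · rw [Subgroup.mem_centralizer_singleton_iff]; exact (cj_eq_self.1 hx).symm
    · rw [Subgroup.mem_centralizer_singleton_iff]; exact (cj_eq_self.1 hy).symm
  have hg : g ∈ Subgroup.center G := by
    rw [Subgroup.mem_center_iff]
    intro z
    have : z ∈ Subgroup.centralizer {g} := by rw [this]; trivial
    rwa [Subgroup.mem_centralizer_singleton_iff] at this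
  rw [hZ] at hg
  simpa using hg

theorem Gen.eq_of_cj {x y g k : G} (h : Gen x y) (hZ : Subgroup.center G = ⊥)
    (hx : cj g x = cj k x) (hy : cj g y = cj k y) : g = k := by
  have : g * k⁻¹ = 1 := by
    apply h.eq_one hZ
    · rw [← cj_cj, hx, cj_cj]; simp [cj_one]
    · rw [← cj_cj, hy, cj_cj]; simp [cj_one]
  exact mul_inv_eq_one.1 this

/-- Normal subgroup criterion. -/
theorem Gen.normal [Finite G] {x y : G} (h : Gen x y) {H : Subgroup G}
    (hx : ∀ a ∈ H, cj x a ∈ H) (hy : ∀ a ∈ H, cj y a ∈ H) : H.Normal := by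
  rw [← Subgroup.normalizer_eq_top_iff]
  have key : ∀ z : G, (∀ a ∈ H, cj z a ∈ H) → z ∈ Subgroup.normalizer (H : Set G) := by
    intro z hz
    have := (Subgroup.normalizer (H : Set G)).inv_mem (x := z⁻¹) ?_
    · simpa using this
    rw [Subgroup.mem_normalizer_iff]
    have hinj : Function.Injective (fun a : H => (⟨cj z a, hz a a.2⟩ : H)) := by
      intro a b hab
      simp only [Subtype.mk.injEq, cj_inj] at hab
      exact Subtype.ext hab
    have hsurj := Finite.surjective_of_injective hinj
    intro a
    constructor
    · intro ha; simpa [cj] using hz a ha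
    · intro ha
      obtain ⟨b, hb⟩ := hsurj ⟨_, ha⟩
      have : cj z (b : G) = z⁻¹ * a * z⁻¹⁻¹ := congrArg Subtype.val hb
      simp [cj] at this
      rw [← this]; exact b.2
  exact h.top_le (key x hx) (key y hy)

theorem comm_quot {H : Subgroup G} [H.Normal] {y : G}
    (h : H ⊔ Subgroup.zpowers y = ⊤) : ∀ a b : G ⧸ H, a * b = b * a := by
  have hz : ∀ a : G ⧸ H, a ∈ Subgroup.zpowers (QuotientGroup.mk' H y) := by
    intro a
    obtain ⟨g, rfl⟩ := QuotientGroup.mk'_surjective H a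
    have hle : (⊤ : Subgroup G) ≤
        (Subgroup.zpowers (QuotientGroup.mk' H y)).comap (QuotientGroup.mk' H) := by
      rw [← h, sup_le_iff]
      constructor
      · intro k hk
        rw [Subgroup.mem_comap]
        have : QuotientGroup.mk' H k = 1 := by simpa using hk
        rw [this]; exact one_mem _
      · rw [Subgroup.zpowers_le]; exact Subgroup.mem_zpowers _
    exact hle (Subgroup.mem_top g)
  intro a b
  obtain ⟨i, rfl⟩ := hz a
  obtain ⟨j, rfl⟩ := hz b
  simp only [← zpow_add, add_comm]

/-- A group generated by `x, y` with `x` in an abelian subgroup normalised by `y` is solvable. -/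
theorem Gen.solvable [Finite G] {x y : G} (h : Gen x y) {A : Subgroup G}
    (hc : ∀ a ∈ A, ∀ b ∈ A, Commute a b) (hx : x ∈ A) (hy : ∀ a ∈ A, cj y a ∈ A) :
    Group.IsSolvable G := by
  have : A.Normal := h.normal (fun a ha => mul_mem (mul_mem (inv_mem hx) ha) hx) hy
  have htop : A ⊔ Subgroup.zpowers y = ⊤ :=
    h.top_le (Subgroup.mem_sup_left hx) (Subgroup.mem_sup_right (Subgroup.mem_zpowers y))
  have : Group.IsSolvable A := Group.isSolvable_of_comm (fun a b => Subtype.ext (hc a a.2 b b.2))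
  have : Group.IsSolvable (G ⧸ A) := Group.isSolvable_of_comm (comm_quot htop)
  exact Group.isSolvable_of_ker_le_range A.subtype (QuotientGroup.mk' A) (by simp)

/-- In a perfect group a subgroup normalised by a supplementing element is everything. -/
theorem perfect_top [Finite G] (hP : commutator G = ⊤) {H : Subgroup G} {x y d : G}
    (hxy : Gen x y) (hx : x ∈ H ⊔ Subgroup.zpowers d) (hy : y ∈ H ⊔ Subgroup.zpowers d)
    (hd : ∀ a ∈ H, cj d a ∈ H) : H = ⊤ := by
  have htop : H ⊔ Subgroup.zpowers d = ⊤ := hxy.top_le hx hy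
  have key : H ⊔ Subgroup.zpowers d ≤ Subgroup.normalizer (H : Set G) := by
    rw [sup_le_iff]
    refine ⟨Subgroup.le_normalizer, ?_⟩
    rw [Subgroup.zpowers_le]
    have hinj : Function.Injective (fun a : H => (⟨cj d a, hd a a.2⟩ : H)) := by
      intro a b hab
      simp only [Subtype.mk.injEq, cj_inj] at hab
      exact Subtype.ext hab
    have hsurj := Finite.surjective_of_injective hinj
    have := (Subgroup.normalizer (H : Set G)).inv_mem (x := d⁻¹) ?_
    · simpa using this
    rw [Subgroup.mem_normalizer_iff]
    intro a
    constructor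
    · intro ha; simpa [cj] using hd a ha
    · intro ha
      obtain ⟨b, hb⟩ := hsurj ⟨_, ha⟩
      have : cj d (b : G) = d⁻¹ * a * d⁻¹⁻¹ := congrArg Subtype.val hb
      simp [cj] at this
      rw [← this]; exact b.2
  have : H.Normal := by
    rw [← Subgroup.normalizer_eq_top_iff, eq_top_iff, ← htop]; exact key
  have hcomm := comm_quot htop
  have : commutator G ≤ H := by
    rw [commutator_eq_closure, Subgroup.closure_le]
    rintro _ ⟨a, b, rfl⟩
    have : QuotientGroup.mk' H ⁅a, b⁆ = 1 := by
      rw [map_commutatorElement, commutatorElement_eq_one_iff_mul_comm]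
      exact hcomm _ _
    exact (QuotientGroup.eq_one_iff _).1 this
  rw [eq_top_iff, ← hP]; exact this

/-- If every element appearing in a generating pair squares or cubes to one, `G` is solvable. -/
theorem solvable_two_two [Finite G] {x y : G} (h : Gen x y) (hx : x ^ 2 = 1) (hy : y ^ 2 = 1) :
    Group.IsSolvable G := by
  have hx' : x⁻¹ = x := by rw [inv_eq_iff_mul_eq_one, ← pow_two, hx]
  have hy' : y⁻¹ = y := by rw [inv_eq_iff_mul_eq_one, ← pow_two, hy]
  refine h.mull.solvable (A := Subgroup.zpowers (x * y)) ?_ (Subgroup.mem_zpowers _) ?_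
  · rintro _ ⟨i, rfl⟩ _ ⟨j, rfl⟩; exact (Commute.refl _).zpow_zpow _ _
  · rintro _ ⟨i, rfl⟩
    refine ⟨-i, ?_⟩
    have : cj y (x * y) = (x * y)⁻¹ := by
      simp only [cj, mul_inv_rev, hx', hy']
      rw [mul_assoc, mul_assoc, ← pow_two, hy, mul_one]
    have h2 : cj y ((x * y) ^ i) = (cj y (x * y)) ^ i := by
      have := conj_zpow (i := i) (a := y⁻¹) (b := x * y)
      simp only [inv_inv] at this
      simp only [cj]; exact this.symm
    simp only [h2, this, inv_zpow, zpow_neg]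

theorem solvable_of_cube [Finite G] {x y : G} (h : Gen x y) (hy : y ^ 3 = 1)
    (hc : Commute x (cj y x)) : Group.IsSolvable G := by
  have hconj : ∀ {a b : G} (g : G), Commute a b → Commute (cj g a) (cj g b) := by
    intro a b g hab
    unfold Commute SemiconjBy at *
    rw [← cj_mul, ← cj_mul, hab]
  have e3 : cj y (cj y (cj y x)) = x := by
    rw [cj_cj, cj_cj]
    have : y * (y * y) = 1 := by rw [← hy, pow_succ, pow_two, mul_assoc]
    rw [this, cj_one]
  have h12 := hconj y hc
  have h20 := hconj y h12
  rw [e3] at h20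
  set x1 := cj y x with hx1
  set x2 := cj y x1 with hx2
  have hcc : ∀ a ∈ ({x, x1, x2} : Set G), ∀ b ∈ ({x, x1, x2} : Set G), Commute a b := by
    rintro a (rfl | rfl | rfl) b (rfl | rfl | rfl) <;>
      first | exact Commute.refl _ | assumption | (apply Commute.symm; assumption)
  refine h.solvable (A := Subgroup.closure {x, x1, x2}) ?_
    (Subgroup.subset_closure (by simp)) ?_
  · intro a ha b hb
    induction ha, hb using Subgroup.closure_induction₂ with
    | mem a b ha hb => exact hcc a ha b hb
    | one_left => exact Commute.one_left _
    | one_right => exact Commute.one_right _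
    | mul_left _ _ _ _ _ _ h1 h2 => exact h1.mul_left h2
    | mul_right _ _ _ _ _ _ h1 h2 => exact h1.mul_right h2
    | inv_left _ _ _ _ h1 => exact h1.inv_left
    | inv_right _ _ _ _ h1 => exact h1.inv_right
  · intro a ha
    induction ha using Subgroup.closure_induction with
    | mem a ha =>
      apply Subgroup.subset_closure
      rcases ha with rfl | rfl | rfl
      · simp [hx1]
      · simp [hx2]
      · simp [e3]
    | one => rw [cj_id]; exact one_mem _
    | mul a b _ _ h1 h2 => rw [cj_mul]; exact mul_mem h1 h2
    | inv a _ h1 => rw [cj_inv]; exact inv_mem h1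

theorem solvable_233 [Finite G] {x y : G} (h : Gen x y) (hx : x ^ 2 = 1) (hy : y ^ 3 = 1)
    (hxy : (x * y) ^ 3 = 1) : Group.IsSolvable G := by
  have hx' : x⁻¹ = x := by rw [inv_eq_iff_mul_eq_one, ← pow_two, hx]
  have hy2 : y ^ 2 = y⁻¹ := by rw [eq_inv_iff_mul_eq_one, ← pow_succ, hy]
  have hyy : y * y = y⁻¹ := by rw [← pow_two, hy2]
  refine solvable_of_cube h hy ?_
  -- x * (y x y⁻¹) * (y⁻¹ x y) = 1
  have e : x * (y * x * y⁻¹) * (y⁻¹ * x * y) = 1 := by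
    rw [← hxy, pow_succ, pow_two]
    have : y⁻¹ * y⁻¹ = y := by rw [← mul_inv_rev, hyy, inv_inv]
    calc x * (y * x * y⁻¹) * (y⁻¹ * x * y) = x * y * x * (y⁻¹ * y⁻¹) * x * y := by group
      _ = _ := by rw [this]; group
  have hs : (cj y x) ^ 2 = 1 := by rw [← cj_pow, hx, cj_id]
  have hs' : (cj y x)⁻¹ = cj y x := by rw [inv_eq_iff_mul_eq_one, ← pow_two, hs]
  have hm : y * x * y⁻¹ = x * cj y x := by
    have : x * (y * x * y⁻¹) = (cj y x)⁻¹ := by rw [eq_inv_iff_mul_eq_one]; exact e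
    rw [hs'] at this
    rw [← this, ← mul_assoc, ← pow_two, hx, one_mul]
  have hms : (x * cj y x) ^ 2 = 1 := by
    rw [← hm]
    have : y * x * y⁻¹ = cj y⁻¹ x := by simp [cj]
    rw [this, ← cj_pow, hx, cj_id]
  have : (x * cj y x)⁻¹ = x * cj y x := by rw [inv_eq_iff_mul_eq_one, ← pow_two, hms]
  rw [mul_inv_rev, hx', hs'] at this
  exact this.symm

theorem solvable_333 [Finite G] {x y : G} (h : Gen x y) (hy : y ^ 3 = 1)
    (hxy : (x * y) ^ 3 = 1) (hxy' : (x * y⁻¹) ^ 3 = 1) : Group.IsSolvable G := by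
  have hy2 : y ^ 2 = y⁻¹ := by rw [eq_inv_iff_mul_eq_one, ← pow_succ, hy]
  have hyy : y * y = y⁻¹ := by rw [← pow_two, hy2]
  have hyy' : y⁻¹ * y⁻¹ = y := by rw [← mul_inv_rev, hyy, inv_inv]
  refine solvable_of_cube h hy ?_
  have e1 : x * (y * x * y⁻¹) * (y⁻¹ * x * y) = 1 := by
    rw [← hxy, pow_succ, pow_two]
    calc x * (y * x * y⁻¹) * (y⁻¹ * x * y) = x * y * x * (y⁻¹ * y⁻¹) * x * y := by group
      _ = _ := by rw [hyy']; group
  have e2 : x * (y⁻¹ * x * y) * (y * x * y⁻¹) = 1 := by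
    rw [← hxy', pow_succ, pow_two]
    calc x * (y⁻¹ * x * y) * (y * x * y⁻¹) = x * y⁻¹ * x * (y * y) * x * y⁻¹ := by group
      _ = _ := by rw [hyy]; group
  change x * (y⁻¹ * x * y) = (y⁻¹ * x * y) * x
  -- u v = v u where u = y x y⁻¹, v = y⁻¹ x y, and x = (u v)⁻¹
  have f1 : x⁻¹ = (y * x * y⁻¹) * (y⁻¹ * x * y) := by
    rw [inv_eq_iff_mul_eq_one, ← mul_assoc]; exact e1
  have f2 : x⁻¹ = (y⁻¹ * x * y) * (y * x * y⁻¹) := by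
    rw [inv_eq_iff_mul_eq_one, ← mul_assoc]; exact e2
  have hc : Commute (y⁻¹ * x * y) x⁻¹ := by
    unfold Commute SemiconjBy
    conv_lhs => rw [f1]
    rw [f2]; simp only [mul_assoc]
  have := hc.inv_right
  rw [inv_inv] at this
  exact this.symm

/-- If every element appearing in a generating pair squares or cubes to one, `G` is solvable. -/
theorem solvable_of_orders [Finite G] {x y : G} (h : Gen x y)
    (hall : ∀ u v : G, Gen u v → u ^ 2 = 1 ∨ u ^ 3 = 1) : Group.IsSolvable G := by
  have step : ∀ u v : G, Gen u v → u ^ 2 = 1 → Group.IsSolvable G := by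
    intro u v huv hu
    rcases hall v u huv.swap with hv | hv
    · exact solvable_two_two huv hu hv
    rcases hall (u * v) v huv.mull with hw | hw
    · exact solvable_two_two huv.mulr hu hw
    · exact solvable_233 huv hu hv hw
  rcases hall y x h.swap with hv | hv
  · exact step y x h.swap hv
  have h2 : Gen (x * y⁻¹) y⁻¹ := h.invr.mull
  rcases hall _ _ h.mull with hw | hw
  · exact step _ _ h.mull hw
  rcases hall _ _ h2 with hw' | hw'
  · exact step _ _ h2 hw'
  exact solvable_333 h hv hw hw'

end FewGen

namespace FewGen
section tower
variable {G : Type*} [Group G]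

/-- The abelian subgroups occurring in the tower over `x` with respect to `y`. -/
structure Tow (x y : G) (A : Subgroup G) : Prop where
  mem : x ∈ A
  comm : ∀ a ∈ A, ∀ b ∈ A, Commute a b
  gen : ∀ t, (∀ a ∈ A, Commute a t) → Subgroup.closure ((A : Set G) ∪ {y * t}) = ⊤ →
    Gen x (y * t)
  cen : ∀ d t₀ t, Commute d x → (∀ a ∈ A, Commute a t₀) → (∀ a ∈ A, Commute a t) →
    Gen x (y * t₀) → cj d (y * t₀) = y * t → ∀ a ∈ A, Commute a d

theorem Tow.base (x y : G) : Tow x y (Subgroup.zpowers x) where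
  mem := Subgroup.mem_zpowers x
  comm := by rintro _ ⟨i, rfl⟩ _ ⟨j, rfl⟩; exact (Commute.refl _).zpow_zpow _ _
  gen := by
    intro t _ h
    unfold Gen
    rw [eq_top_iff, ← h, Subgroup.closure_le]
    rintro z (hz | hz)
    · exact (Subgroup.zpowers_le.2 (mem_l x (y * t))) hz
    · rw [Set.mem_singleton_iff] at hz
      rw [hz]; exact mem_r _ _
  cen := by
    rintro d t₀ t hd - - - - _ ⟨i, rfl⟩
    exact (hd.symm).zpow_left i

theorem Tow.gen_mem {x y : G} (h : Gen x y) {A : Subgroup G} (hA : Tow x y A) {t : G}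
    (ht : t ∈ A) : Gen x (y * t) := by
  apply hA.gen t (fun a ha => hA.comm a ha t ht)
  apply h.top_le
  · exact Subgroup.subset_closure (Or.inl hA.mem)
  · have h1 : y * t ∈ Subgroup.closure ((A : Set G) ∪ {y * t}) :=
      Subgroup.subset_closure (Or.inr rfl)
    have h2 : t ∈ Subgroup.closure ((A : Set G) ∪ {y * t}) :=
      Subgroup.subset_closure (Or.inl ht)
    simpa using mul_mem h1 (inv_mem h2)

theorem commute_sup {A : Subgroup G} {d z : G} (h1 : ∀ a ∈ A, Commute a z) (h2 : Commute d z) :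
    ∀ a ∈ A ⊔ Subgroup.zpowers d, Commute a z := by
  have : A ⊔ Subgroup.zpowers d ≤ Subgroup.centralizer {z} := by
    rw [sup_le_iff, Subgroup.zpowers_le]
    refine ⟨fun a ha => ?_, ?_⟩
    · rw [Subgroup.mem_centralizer_singleton_iff]; exact h1 a ha
    · rw [Subgroup.mem_centralizer_singleton_iff]; exact h2
  intro a ha
  have := this ha
  rw [Subgroup.mem_centralizer_singleton_iff] at this
  exact this

theorem Tow.step [Finite G] (hP : commutator G = ⊤) (hZ : Subgroup.center G = ⊥) {x y : G}
    (h : Gen x y) {A : Subgroup G} (hA : Tow x y A) {d c : G} (hd : ∀ a ∈ A, Commute a d)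
    (hc : c ∈ A) (hdc : cj d y = y * c) : Tow x y (A ⊔ Subgroup.zpowers d) where
  mem := Subgroup.mem_sup_left hA.mem
  comm := by
    intro a ha b hb
    refine commute_sup (fun a' ha' => ?_) ?_ a ha
    · exact (commute_sup (fun b' hb' => hA.comm b' hb' a' ha') (hd a' ha').symm b hb).symm
    · exact (commute_sup hd (Commute.refl d) b hb).symm
  gen := by
    intro t ht htop
    have htA : ∀ a ∈ A, Commute a t := fun a ha => ht a (Subgroup.mem_sup_left ha)
    have htd : Commute d t := ht d (Subgroup.mem_sup_right (Subgroup.mem_zpowers d))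
    apply hA.gen t htA
    have hle : (⊤ : Subgroup G) ≤
        Subgroup.closure ((A : Set G) ∪ {y * t}) ⊔ Subgroup.zpowers d := by
      rw [← htop, Subgroup.closure_le]
      rintro z (hz | hz)
      · have : A ⊔ Subgroup.zpowers d ≤
            Subgroup.closure ((A : Set G) ∪ {y * t}) ⊔ Subgroup.zpowers d := by
          apply sup_le_sup_right
          intro a ha
          exact Subgroup.subset_closure (Or.inl ha)
        exact this hz
      · exact Subgroup.mem_sup_left (Subgroup.subset_closure (Or.inr hz))
    refine perfect_top hP h (d := d) (hle trivial) (hle trivial) ?_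
    intro a ha
    induction ha using Subgroup.closure_induction with
    | mem a ha =>
      rcases ha with ha | ha
      · rw [cj_eq_self.2 (hd a ha).symm]
        exact Subgroup.subset_closure (Or.inl ha)
      · rw [Set.mem_singleton_iff] at ha
        rw [ha, cj_mul, hdc, cj_eq_self.2 htd, mul_assoc, (htA c hc).eq, ← mul_assoc]
        exact mul_mem (Subgroup.subset_closure (Or.inr rfl))
          (Subgroup.subset_closure (Or.inl hc))
    | one => rw [cj_id]; exact one_mem _
    | mul a b _ _ h1 h2 => rw [cj_mul]; exact mul_mem h1 h2
    | inv a _ h1 => rw [cj_inv]; exact inv_mem h1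
  cen := by
    intro e t₀ t hex ht₀ ht hgen he
    have hinA : ∀ a ∈ A, a ∈ A ⊔ Subgroup.zpowers d := fun a ha => Subgroup.mem_sup_left ha
    have hind : d ∈ A ⊔ Subgroup.zpowers d := Subgroup.mem_sup_right (Subgroup.mem_zpowers d)
    have heA : ∀ a ∈ A, Commute a e := hA.cen e t₀ t hex (fun a ha => ht₀ a (hinA a ha))
      (fun a ha => ht a (hinA a ha)) hgen he
    refine commute_sup heA ?_
    -- `cj d (y t₀) = y t₀ c` and `cj d (y t) = y t c`
    have k : ∀ s, (∀ a ∈ A ⊔ Subgroup.zpowers d, Commute a s) → cj d (y * s) = y * s * c := by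
      intro s hs
      rw [cj_mul, hdc, cj_eq_self.2 (hs d hind), mul_assoc, (hs c (hinA c hc)).eq, mul_assoc]
    have : d * e = e * d := by
      refine hgen.eq_of_cj hZ ?_ ?_
      · have dx : cj d x = x := cj_eq_self.2 (hd x hA.mem).symm
        have ex : cj e x = x := cj_eq_self.2 hex
        rw [← cj_cj, ← cj_cj, dx, ex, dx]
      · rw [← cj_cj, ← cj_cj, k t₀ ht₀, he, k t ht, cj_mul, he, cj_eq_self.2 (heA c hc).symm]
    exact this

/-- The maximal tower element. -/
theorem exists_tower [Finite G] (hP : commutator G = ⊤) (hZ : Subgroup.center G = ⊥) {x y : G}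
    (h : Gen x y) : ∃ A : Subgroup G, Tow x y A ∧
      ∀ d t₀ t, Commute d x → t₀ ∈ A → t ∈ A → cj d (y * t₀) = y * t → d ∈ A := by
  obtain ⟨A, -, hA⟩ := Finite.exists_le_maximal (p := Tow x y) (Tow.base x y)
  refine ⟨A, hA.prop, ?_⟩
  intro d t₀ t hdx ht₀ ht hd
  have hdA : ∀ a ∈ A, Commute a d := hA.prop.cen d t₀ t hdx
    (fun a ha => hA.prop.comm a ha t₀ ht₀) (fun a ha => hA.prop.comm a ha t ht)
    (hA.prop.gen_mem h ht₀) hd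
  have hdc : cj d y = y * (t * t₀⁻¹) := by
    rw [cj_mul, cj_eq_self.2 (hdA t₀ ht₀).symm] at hd
    rw [← mul_assoc, ← hd, mul_inv_cancel_right]
  have := hA.prop.step hP hZ h hdA (mul_mem ht (inv_mem ht₀)) hdc
  exact hA.le_of_ge this le_sup_left (Subgroup.mem_sup_right (Subgroup.mem_zpowers d))

end tower

section classes

variable (G : Type*) [Group G]

/-- Generating pairs. -/
abbrev Epi := {p : G × G // Gen p.1 p.2}

/-- Simultaneous conjugacy of generating pairs. -/
def epiSetoid : Setoid (Epi G) where
  r p q := ∃ g, cj g p.1.1 = q.1.1 ∧ cj g p.1.2 = q.1.2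
  iseqv := by
    refine ⟨fun p => ⟨1, cj_one _, cj_one _⟩, ?_, ?_⟩
    · rintro p q ⟨g, h1, h2⟩
      refine ⟨g⁻¹, ?_, ?_⟩
      · rw [← h1, cj_cj]; simp [cj_one]
      · rw [← h2, cj_cj]; simp [cj_one]
    · rintro p q r ⟨g, h1, h2⟩ ⟨k, h3, h4⟩
      refine ⟨g * k, ?_, ?_⟩
      · rw [← cj_cj, h1, h3]
      · rw [← cj_cj, h2, h4]

/-- Classes of generating pairs. -/
abbrev XX := Quotient (epiSetoid G)

variable {G}

/-- The class of a generating pair. -/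
def cls {x y : G} (h : Gen x y) : XX G := Quotient.mk (epiSetoid G) ⟨(x, y), h⟩

theorem cls_eq {x y u v : G} (h : Gen x y) (k : Gen u v) :
    cls h = cls k ↔ ∃ g, cj g x = u ∧ cj g y = v := by
  unfold cls
  rw [Quotient.eq]
  rfl

theorem cls_ind {P : XX G → Prop} (H : ∀ (x y : G) (h : Gen x y), P (cls h)) (q : XX G) : P q := by
  induction q using Quotient.inductionOn with
  | h p => exact H p.1.1 p.1.2 p.2

theorem card_XX [Finite G] (hZ : Subgroup.center G = ⊥) :
    Nat.card (XX G) * Nat.card G ≤ Nat.card (Epi G) := by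
  rw [← Nat.card_prod]
  refine Nat.card_le_card_of_injective
    (fun p : XX G × G => (⟨(cj p.2 p.1.out.1.1, cj p.2 p.1.out.1.2),
      p.1.out.2.conj p.2⟩ : Epi G)) ?_
  rintro ⟨q, g⟩ ⟨r, k⟩ h
  simp only [Subtype.mk.injEq, Prod.mk.injEq] at h
  have hqr : q = r := by
    rw [← Quotient.out_eq q, ← Quotient.out_eq r, Quotient.eq]
    refine ⟨g * k⁻¹, ?_, ?_⟩
    · rw [← cj_cj, h.1, cj_cj]; simp [cj_one]
    · rw [← cj_cj, h.2, cj_cj]; simp [cj_one]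
  subst hqr
  have := q.out.2.eq_of_cj hZ h.1 h.2
  rw [this]

/-- Conjugacy class of the first coordinate: the classes having `x` as first coordinate. -/
def fib (x : G) : Set (XX G) := {q | ∃ (y : G) (h : Gen x y), q = cls h}

theorem fib_conj (x g : G) : fib x ⊆ fib (cj g x) := by
  rintro q ⟨y, h, rfl⟩
  exact ⟨cj g y, h.conj g, (cls_eq _ _).2 ⟨g, rfl, rfl⟩⟩

theorem mem_fib {x u v : G} (h : Gen u v) (hm : cls h ∈ fib x) : ∃ g, cj g u = x := by
  obtain ⟨y, hy, he⟩ := hm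
  obtain ⟨g, h1, -⟩ := (cls_eq _ _).1 he
  exact ⟨g, h1⟩

theorem fib_lower [Finite G] (hP : commutator G = ⊤) (hZ : Subgroup.center G = ⊥) {x y : G}
    (h : Gen x y) : ∃ A : Subgroup G, x ∈ A ∧ (∀ a ∈ A, ∀ b ∈ A, Commute a b) ∧
      ∃ D : Subgroup A, D.index ≤ (fib x).ncard ∧ ∀ d ∈ D, cj y (d : G) ∈ A := by
  obtain ⟨A, hA, hmax⟩ := exists_tower hP hZ h
  refine ⟨A, hA.mem, hA.comm, ?_⟩
  let D : Subgroup A :=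
    { carrier := {d | cj y (d : G) ∈ A}
      one_mem' := by
        change cj y (1 : G) ∈ A
        rw [cj_id]; exact one_mem _
      mul_mem' := by
        intro a b ha hb
        change cj y ((a : G) * b) ∈ A
        rw [cj_mul]; exact mul_mem ha hb
      inv_mem' := by
        intro a ha
        change cj y ((a : G)⁻¹) ∈ A
        rw [cj_inv]; exact inv_mem ha }
  refine ⟨D, ?_, fun d hd => hd⟩
  have hmul := D.card_mul_index
  have hpos : 0 < Nat.card D := Nat.card_pos
  suffices hs : Nat.card A ≤ Nat.card D * (fib x).ncard by
    rw [← hmul] at hs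
    exact Nat.le_of_mul_le_mul_left hs hpos
  classical
  have := Fintype.ofFinite A
  have := Fintype.ofFinite D
  let f : A → XX G := fun t => cls (hA.gen_mem h t.2)
  have hfin : (fib x).Finite := Set.toFinite _
  have key := Finset.card_le_mul_card_image_of_maps_to (s := (Finset.univ : Finset A))
    (t := hfin.toFinset) (f := f) (n := Nat.card D) (by
      intro t _
      rw [Set.Finite.mem_toFinset]
      exact ⟨_, hA.gen_mem h t.2, rfl⟩) ?_
  · rw [Finset.card_univ, ← Nat.card_eq_fintype_card, ← Set.ncard_eq_toFinset_card _ hfin] at key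
    exact key
  · intro q _
    by_cases hq : ∃ t₀ : A, f t₀ = q
    · obtain ⟨t₀, rfl⟩ := hq
      have hsub : (Finset.univ.filter (fun t => f t = f t₀)) ⊆
          (Finset.univ : Finset D).image (fun d : D => if hd : cj y ((d : A) : G) ∈ A then
            (⟨cj y ((d : A) : G), hd⟩ : A)⁻¹ * (d : A) * t₀ else 1) := by
        intro t ht
        rw [Finset.mem_filter] at ht
        obtain ⟨g, hg1, hg2⟩ := (cls_eq _ _).1 ht.2.symm
        have hgA : g ∈ A := hmax g t₀ t (cj_eq_self.1 hg1) t₀.2 t.2 hg2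
        rw [cj_mul, cj_eq_self.2 (hA.comm g hgA t₀ t₀.2)] at hg2
        -- g⁻¹ y g t₀ = y t
        have e : (t : G) = (cj y g)⁻¹ * g * t₀ := by
          have : (t : G) = y⁻¹ * (cj g y * t₀) := by rw [hg2]; simp
          rw [this]; simp only [cj]; group
        have hgD : cj y g ∈ A := by
          have : cj y g = g * t₀ * (t : G)⁻¹ := by rw [e]; group
          rw [this]
          exact mul_mem (mul_mem hgA t₀.2) (inv_mem t.2)
        rw [Finset.mem_image]
        refine ⟨⟨⟨g, hgA⟩, hgD⟩, Finset.mem_univ _, ?_⟩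
        rw [dif_pos hgD]
        apply Subtype.ext
        simp [e]
      calc _ ≤ _ := Finset.card_le_card hsub
        _ ≤ _ := Finset.card_image_le
        _ = _ := by rw [Finset.card_univ, Nat.card_eq_fintype_card]
    · have : (Finset.univ.filter (fun t => f t = q)) = ∅ := by
        rw [Finset.filter_eq_empty_iff]
        intro t _ ht
        exact hq ⟨t, ht⟩
      rw [this]; simp

theorem fib_two [Finite G] (hP : commutator G = ⊤) (hZ : Subgroup.center G = ⊥)
    (hS : ¬ Group.IsSolvable G) {x y : G} (h : Gen x y) : 2 ≤ (fib x).ncard := by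
  by_contra hlt
  obtain ⟨A, hx, hc, D, hD, hy⟩ := fib_lower hP hZ h
  have h1 : D.index = 1 := by
    have : D.index ≠ 0 := Subgroup.index_ne_zero_of_finite
    omega
  rw [Subgroup.index_eq_one] at h1
  exact hS (h.solvable hc hx (fun a ha => hy ⟨a, ha⟩ (by rw [h1]; trivial)))

theorem fib_three [Finite G] (hP : commutator G = ⊤) (hZ : Subgroup.center G = ⊥)
    (hS : ¬ Group.IsSolvable G) {x y : G} (h : Gen x y) (hx3 : x ^ 3 = 1) :
    3 ≤ (fib x).ncard := by
  by_contra hlt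
  obtain ⟨A, hx, hc, D, hD, hy⟩ := fib_lower hP hZ h
  have hsq : ∀ a ∈ A, cj y (a ^ 2) ∈ A := by
    intro a ha
    have h2 := fib_two hP hZ hS h
    have hi : D.index = 1 ∨ D.index = 2 := by
      have : D.index ≠ 0 := Subgroup.index_ne_zero_of_finite
      omega
    have : (⟨a, ha⟩ : A) ^ 2 ∈ D := by
      rcases hi with h1 | h1
      · rw [Subgroup.index_eq_one] at h1; rw [h1]; trivial
      · exact Subgroup.sq_mem_of_index_two h1 _
    exact hy _ this
  have hcu : ∀ a ∈ A, a ^ 3 = 1 → cj y a ∈ A := by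
    intro a ha h3
    have := hsq (a ^ 2) (pow_mem ha 2)
    have e : (a ^ 2) ^ 2 = a := by
      rw [← pow_mul]; rw [show 2 * 2 = 3 + 1 from rfl, pow_succ, h3, one_mul]
    rwa [e] at this
  let B : Subgroup G :=
    { carrier := {a | a ∈ A ∧ a ^ 3 = 1}
      one_mem' := ⟨one_mem _, one_pow _⟩
      mul_mem' := by
        rintro a b ⟨ha, ha3⟩ ⟨hb, hb3⟩
        exact ⟨mul_mem ha hb, by rw [(hc a ha b hb).mul_pow, ha3, hb3, one_mul]⟩
      inv_mem' := by
        rintro a ⟨ha, ha3⟩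
        exact ⟨inv_mem ha, by rw [inv_pow, ha3, inv_one]⟩ }
  refine hS (h.solvable (A := B) (fun a ha b hb => hc a ha.1 b hb.1) ⟨hx, hx3⟩ ?_)
  rintro a ⟨ha, ha3⟩
  exact ⟨hcu a ha ha3, by rw [← cj_pow, ha3, cj_id]⟩

end classes

end FewGen

namespace FewGen
section perfect
variable {G : Type*} [Group G]

theorem exists_fixed {α : Type*} [Finite α] {p : ℕ} [Fact p.Prime] (f : Function.End α)
    (hf : f ^ p = 1) (hn : ¬ p ∣ Nat.card α) : ∃ a, f a = a := by
  classical
  have := Fintype.ofFinite α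
  by_contra hne
  push Not at hne
  have := Equiv.Perm.card_fixedPoints_modEq (f := f) (p := p) (n := 1) (by simpa using hf)
  have h0 : Fintype.card α ≡ 0 [MOD p] := by
    refine this.trans ?_
    have hz : IsEmpty f.fixedPoints := ⟨fun a => hne a.1 a.2⟩
    have e := @Fintype.card_eq_zero_iff f.fixedPoints _ |>.2 hz
    exact (congrArg (· % p) e)
  rw [← Nat.card_eq_fintype_card, Nat.modEq_zero_iff_dvd] at h0
  exact hn h0

/-- The swap on classes. -/
def sw : XX G → XX G := Quotient.map'
  (fun p : Epi G => (⟨(p.1.2, p.1.1), p.2.swap⟩ : Epi G)) (by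
    rintro p q ⟨g, h1, h2⟩
    exact ⟨g, h2, h1⟩)

theorem Gen.rot {x y : G} (h : Gen x y) : Gen y (x * y)⁻¹ := h.mull.swap.invr

/-- The rotation on classes. -/
def rt : XX G → XX G := Quotient.map'
  (fun p : Epi G => (⟨(p.1.2, (p.1.1 * p.1.2)⁻¹), p.2.rot⟩ : Epi G)) (by
    rintro p q ⟨g, h1, h2⟩
    exact ⟨g, h2, by simp only [cj_inv, cj_mul, h1, h2]⟩)

theorem sw_cls {x y : G} (h : Gen x y) : sw (cls h) = cls h.swap := rfl
theorem rt_cls {x y : G} (h : Gen x y) : rt (cls h) = cls h.rot := rfl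

theorem cls_congr {x y u v : G} (h : Gen x y) (k : Gen u v) (h1 : x = u) (h2 : y = v) :
    cls h = cls k := by subst h1 h2; rfl

theorem exists_c2 [Finite G] (hZ : Subgroup.center G = ⊥) (hn : ¬ 2 ∣ Nat.card (XX G)) :
    ∃ c x : G, Gen c x ∧ c ^ 2 = 1 := by
  obtain ⟨q, hq⟩ := exists_fixed (p := 2) (sw : Function.End (XX G)) (by
    funext q
    induction q using cls_ind with
    | H x y h => rfl) hn
  induction q using cls_ind with
  | H x y h =>
    rw [sw_cls] at hq
    obtain ⟨c, h1, h2⟩ := (cls_eq _ _).1 hq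
    refine ⟨c, y, h.of_mem ?_ (mem_r _ _), ?_⟩
    · rw [← h1]
      exact mul_mem (mul_mem (inv_mem (mem_l _ _)) (mem_r _ _)) (mem_l _ _)
    · refine h.eq_one hZ ?_ ?_
      · rw [pow_two, ← cj_cj, h2, h1]
      · rw [pow_two, ← cj_cj, h1, h2]

theorem exists_c3 [Finite G] (hZ : Subgroup.center G = ⊥) (hn : ¬ 3 ∣ Nat.card (XX G)) :
    ∃ c x : G, Gen c x ∧ c ^ 3 = 1 := by
  obtain ⟨q, hq⟩ := exists_fixed (p := 3) (rt : Function.End (XX G)) (by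
    funext q
    induction q using cls_ind with
    | H x y h =>
      change rt (rt (rt (cls h))) = cls h
      rw [rt_cls, rt_cls, rt_cls]
      apply cls_congr
      · group
      · group) hn
  induction q using cls_ind with
  | H x y h =>
    rw [rt_cls] at hq
    obtain ⟨c, h1, h2⟩ := (cls_eq _ _).1 hq.symm
    have h3 : cj c (x * y)⁻¹ = x := by
      rw [cj_inv, cj_mul, h1, h2]; group
    refine ⟨c, x, h.of_mem (mem_r _ _) ?_, ?_⟩
    · rw [← h1]
      exact mul_mem (mul_mem (inv_mem (mem_l _ _)) (mem_r _ _)) (mem_l _ _)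
    · have e : c ^ 3 = c * c * c := by rw [pow_succ, pow_two]
      refine h.eq_one hZ ?_ ?_
      · rw [e, ← cj_cj, ← cj_cj, h1, h2, h3]
      · rw [e, ← cj_cj, ← cj_cj, h2, h3, h1]

theorem pow_cj {c u : G} {n : ℕ} (hc : c ^ n = 1) (h : ∃ g, cj g u = c) : u ^ n = 1 := by
  obtain ⟨g, rfl⟩ := h
  rw [← cj_pow] at hc
  rwa [← cj_id g, cj_inj] at hc

theorem fib_disj {a b : G} (h : ¬ ∃ g, cj g a = b) : Disjoint (fib a) (fib b) := by
  rw [Set.disjoint_left]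
  rintro q ⟨y, hy, rfl⟩ hb
  exact h (mem_fib hy hb)

theorem perfect_case [Finite G] (hP : commutator G = ⊤) (hZ : Subgroup.center G = ⊥)
    (hS : ¬ Group.IsSolvable G) {x y : G} (h : Gen x y) (hN : Nat.card (XX G) ≤ 5) : False := by
  apply hS
  have hpos : 0 < Nat.card (XX G) := by
    have : Nonempty (XX G) := ⟨cls h⟩
    exact Nat.card_pos
  have hle : ∀ s : Set (XX G), s.ncard ≤ Nat.card (XX G) := fun s => Set.ncard_le_card s
  have hle2 : ∀ a b : G, (¬ ∃ g, cj g a = b) → (fib a).ncard + (fib b).ncard ≤ Nat.card (XX G) := by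
    intro a b hab
    rw [← Set.ncard_union_eq (fib_disj hab)]
    exact hle _
  have h2 : ∀ u v : G, Gen u v → 2 ≤ (fib u).ncard := fun u v huv => fib_two hP hZ hS huv
  have h3 : ∀ u v : G, Gen u v → u ^ 3 = 1 → 3 ≤ (fib u).ncard :=
    fun u v huv hu => fib_three hP hZ hS huv hu
  apply solvable_of_orders h
  intro u v huv
  by_cases d3 : 3 ∣ Nat.card (XX G)
  · obtain ⟨c, z, hc, hc2⟩ := exists_c2 hZ (by omega)
    left
    refine pow_cj hc2 ?_
    by_contra hne
    have := hle2 _ _ hne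
    have := h2 _ _ huv
    have := h2 _ _ hc
    omega
  · obtain ⟨c, z, hc, hc3⟩ := exists_c3 hZ d3
    have k3 := h3 _ _ hc hc3
    by_cases d2 : 2 ∣ Nat.card (XX G)
    · right
      refine pow_cj hc3 ?_
      by_contra hne
      have := hle2 _ _ hne
      have := h2 _ _ huv
      omega
    · by_contra hu
      push Not at hu
      obtain ⟨b, w, hb, hb2⟩ := exists_c2 hZ d2
      have n1 : ¬ ∃ g, cj g u = b := fun hg => hu.1 (pow_cj hb2 hg)
      have n2 : ¬ ∃ g, cj g u = c := fun hg => hu.2 (pow_cj hc3 hg)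
      have n3 : ¬ ∃ g, cj g b = c := by
        intro hg
        have e3 := pow_cj hc3 hg
        have e1 : b = 1 := by
          rw [pow_succ, hb2, one_mul] at e3; exact e3
        have := hb.mulr
        subst e1
        exact hS (solvable_of_orders hb.swap.swap (fun _ _ _ => by
          exfalso
          exact hS (hb.solvable (A := ⊥) (by
            rintro a ha b hb
            rw [Subgroup.mem_bot] at ha hb
            rw [ha]; exact Commute.one_left _) (one_mem _) (by
            intro a ha
            rw [Subgroup.mem_bot] at ha
            rw [ha, cj_id]; exact one_mem _))))
      have hd : Disjoint (fib u) (fib b ∪ fib c) :=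
        Set.disjoint_union_right.2 ⟨fib_disj n1, fib_disj n2⟩
      have := hle (fib u ∪ (fib b ∪ fib c))
      rw [Set.ncard_union_eq hd, Set.ncard_union_eq (fib_disj n3)] at this
      have := h2 _ _ huv
      have := h2 _ _ hb
      omega

end perfect

end FewGen

namespace FewGen
section nonperfect
variable {G : Type*} [Group G] {Q : Type*} [CommGroup Q]

theorem hom_cj (q : G →* Q) (g x : G) : q (cj g x) = q x := by
  simp [cj, mul_comm]

theorem cls_ne (q : G →* Q) {x y u v : G} {h : Gen x y} {k : Gen u v}
    (hne : q x ≠ q u ∨ q y ≠ q v) : cls h ≠ cls k := by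
  intro he
  obtain ⟨g, rfl, rfl⟩ := (cls_eq _ _).1 he
  rw [hom_cj, hom_cj] at hne
  simp at hne

theorem six_le [Finite G] (l : List (XX G)) (hl : l.Nodup) : l.length ≤ Nat.card (XX G) := by
  have := Fintype.ofFinite (XX G)
  rw [Nat.card_eq_fintype_card]
  exact hl.length_le_card

theorem case_generic [Finite G] (q : G →* Q) {x y : G} (h : Gen x y) (hx : q x ≠ 1)
    (hy : q y ≠ 1) (hxy : q x ≠ q y) (hN : Nat.card (XX G) ≤ 5) : False := by
  have h1 : q x ≠ q (x * y) := by rw [map_mul]; simpa using hy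
  have h2 : q y ≠ q (x * y) := by rw [map_mul]; simpa using hx
  have := six_le [cls h, cls h.swap, cls h.mulr, cls h.mulr.swap, cls h.mull.swap, cls h.mull] (by
    simp only [List.nodup_cons, List.mem_cons, List.not_mem_nil, or_false, not_or,
      not_false_eq_true, List.nodup_nil, and_true]
    refine ⟨⟨?_, ?_, ?_, ?_, ?_⟩, ⟨?_, ?_, ?_, ?_⟩, ⟨?_, ?_, ?_⟩, ⟨?_, ?_⟩, ?_⟩ <;>
      apply cls_ne q <;> simp only [ne_eq, h1, h2, hxy, h1.symm, h2.symm, hxy.symm, not_false_eq_true, true_or, or_true])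
  simp at this
  omega

theorem case_inv [Finite G] (q : G →* Q) {x y : G} (h : Gen x y) (hx : q x = 1)
    (hy : q y ^ 2 ≠ 1) (hN : Nat.card (XX G) ≤ 5) : False := by
  have h1 : q y ≠ 1 := by intro e; simp [e] at hy
  have h2 : q y ≠ (q y)⁻¹ := by
    intro e
    apply hy
    rw [pow_two]
    nth_rw 1 [e]
    simp
  have := six_le [cls h, cls h.invr, cls h.swap, cls h.invr.swap, cls h.mull.swap,
      cls h.invr.mull.swap] (by
    simp only [List.nodup_cons, List.mem_cons, List.not_mem_nil, or_false, not_or,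
      not_false_eq_true, List.nodup_nil, and_true]
    refine ⟨⟨?_, ?_, ?_, ?_, ?_⟩, ⟨?_, ?_, ?_, ?_⟩, ⟨?_, ?_, ?_⟩, ⟨?_, ?_⟩, ?_⟩ <;>
      apply cls_ne q <;> simp only [map_inv, map_mul, hx, one_mul, ne_eq, h1, h2, h1.symm, h2.symm, not_false_eq_true, true_or, or_true, inv_eq_one, one_eq_inv])
  simp at this
  omega

theorem case_two_unique [Finite G] (q : G →* Q) (hq : ∃ g, q g ≠ 1)
    (hN : Nat.card (XX G) ≤ 5) {x y u v : G} (h : Gen x y) (k : Gen u v) (hx : q x = 1)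
    (hu : q u = 1) : ∃ g, cj g x = u ∧ cj g y = v := by
  have ne : ∀ {a b : G}, Gen a b → q a = 1 → q b ≠ 1 := by
    intro a b hab ha hb
    obtain ⟨g, hg⟩ := hq
    have := hab.top_le (H := q.ker) ha hb
    exact hg (this.ge (Subgroup.mem_top g))
  have h1 := ne h hx
  have h2 := ne k hu
  by_contra hne
  have := six_le [cls h, cls h.swap, cls h.mull, cls k, cls k.swap, cls k.mull] (by
    simp only [List.nodup_cons, List.mem_cons, List.not_mem_nil, or_false, not_or,
      not_false_eq_true, List.nodup_nil, and_true]
    refine ⟨⟨?_, ?_, ?_, ?_, ?_⟩, ⟨?_, ?_, ?_, ?_⟩, ⟨?_, ?_, ?_⟩, ⟨?_, ?_⟩, ?_⟩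
    case refine_3 =>
      intro e
      exact hne ((cls_eq _ _).1 e)
    case refine_8 =>
      intro e
      obtain ⟨g, e1, e2⟩ := (cls_eq _ _).1 e
      exact hne ⟨g, e2, e1⟩
    case refine_12 =>
      intro e
      obtain ⟨g, e1, e2⟩ := (cls_eq _ _).1 e
      rw [cj_mul, e2, mul_left_inj] at e1
      exact hne ⟨g, e1, e2⟩
    all_goals
      apply cls_ne q
      simp only [map_mul, hx, hu, one_mul, ne_eq, h1, h2, h1.symm, h2.symm, not_false_eq_true,
        true_or, or_true])
  simp at this
  omega

theorem chain_solvable [Finite G] {x y a g : G} (h : Gen x y) (hax : cj a x = x)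
    (hay : cj a y = x * y) (hgx : cj g x = a) (hgy : cj g y = y) : Group.IsSolvable G := by
  let X : ℕ → G := fun i => cj (g ^ i) x
  have X0 : X 0 = x := by simp [X, cj_one]
  have Xs : ∀ i, X (i + 1) = cj g (X i) := by
    intro i; simp only [X]; rw [cj_cj, pow_succ]
  have X1 : X 1 = a := by rw [Xs 0, X0, hgx]
  have rel : ∀ i, y * X (i + 1) * y⁻¹ = X (i + 1) * X i := by
    intro i
    induction i with
    | zero =>
      rw [zero_add, X1, X0]
      have : a * (a⁻¹ * y * a) = a * (x * y) := by
        change a * cj a y = _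
        rw [hay]
      rw [mul_inv_eq_iff_eq_mul, mul_assoc, ← this]; group
    | succ i ih =>
      have := congrArg (cj g) ih
      rw [cj_mul, cj_mul, cj_mul, cj_inv, hgy, ← Xs, ← Xs] at this
      exact this
  have shift : ∀ n, Commute (X 0) (X n) → ∀ i, Commute (X i) (X (i + n)) := by
    intro n hn i
    induction i with
    | zero => rwa [zero_add]
    | succ i ih =>
      rw [show i + 1 + n = (i + n) + 1 by omega, Xs, Xs]
      have := congrArg (cj g) ih.eq
      rw [cj_mul, cj_mul] at this
      exact this
  have com0 : ∀ n, Commute (X 0) (X n) := by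
    intro n
    induction n using Nat.strong_induction_on with
    | _ n ih =>
      match n, ih with
      | 0, _ => exact Commute.refl _
      | 1, _ =>
        rw [X0, X1]
        exact (cj_eq_self.1 hax).symm
      | n + 2, ih =>
        have c1 : Commute (X 1) (X (n + 2)) := by
          have := shift (n + 1) (ih _ (by omega)) 1
          rwa [show 1 + (n + 1) = n + 2 by omega] at this
        have c2 : Commute (X 1) (X (n + 1)) := by
          have := shift n (ih _ (by omega)) 1
          rwa [show 1 + n = n + 1 by omega] at this
        have c3 : Commute (X 0) (X (n + 1)) := ih _ (by omega)
        have c4 : Commute (X 1 * X 0) (X (n + 2) * X (n + 1)) := by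
          rw [← rel 0, ← rel (n + 1)]
          have e := c1.eq
          change _ = _
          calc y * X (0 + 1) * y⁻¹ * (y * X (n + 1 + 1) * y⁻¹)
              = y * (X 1 * X (n + 2)) * y⁻¹ := by simp [mul_assoc]
            _ = _ := by rw [e]; simp [mul_assoc]
        have c5 : Commute (X 1 * X 0) (X (n + 1)) := c2.mul_left c3
        have c6 : Commute (X 1 * X 0) (X (n + 2)) := by
          simpa using c4.mul_right c5.inv_right
        simpa using c1.inv_left.mul_left c6
  have com : ∀ i j, Commute (X i) (X j) := by
    intro i j
    rcases le_total i j with hij | hij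
    · obtain ⟨n, rfl⟩ := Nat.exists_eq_add_of_le hij
      exact shift n (com0 n) i
    · obtain ⟨n, rfl⟩ := Nat.exists_eq_add_of_le hij
      exact (shift n (com0 n) j).symm
  have hcl : ∀ i, X i ∈ Subgroup.closure (Set.range X) :=
    fun i => Subgroup.subset_closure ⟨i, rfl⟩
  refine h.invr.solvable (A := Subgroup.closure (Set.range X)) ?_ ?_ ?_
  · intro u hu v hv
    induction hu, hv using Subgroup.closure_induction₂ with
    | mem u v hu hv =>
      obtain ⟨i, rfl⟩ := hu
      obtain ⟨j, rfl⟩ := hv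
      exact com i j
    | one_left => exact Commute.one_left _
    | one_right => exact Commute.one_right _
    | mul_left _ _ _ _ _ _ h1 h2 => exact h1.mul_left h2
    | mul_right _ _ _ _ _ _ h1 h2 => exact h1.mul_right h2
    | inv_left _ _ _ _ h1 => exact h1.inv_left
    | inv_right _ _ _ _ h1 => exact h1.inv_right
  · rw [← X0]; exact hcl 0
  · intro u hu
    induction hu using Subgroup.closure_induction with
    | mem u hu =>
      obtain ⟨i, rfl⟩ := hu
      have key : ∀ i, cj y⁻¹ (X (i + 1)) ∈ Subgroup.closure (Set.range X) := by
        intro i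
        have : cj y⁻¹ (X (i + 1)) = X (i + 1) * X i := by
          rw [← rel i]; simp [cj]
        rw [this]
        exact mul_mem (hcl _) (hcl _)
      have hpos : 0 < orderOf g := orderOf_pos g
      have per : X i = X (i + (orderOf g - 1) + 1) := by
        simp only [X]
        rw [show i + (orderOf g - 1) + 1 = i + orderOf g by omega, pow_add, pow_orderOf_eq_one,
          mul_one]
      rw [per]
      exact key _
    | one => rw [cj_id]; exact one_mem _
    | mul a b _ _ h1 h2 => rw [cj_mul]; exact mul_mem h1 h2
    | inv a _ h1 => rw [cj_inv]; exact inv_mem h1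

theorem case_two [Finite G] (hZ : Subgroup.center G = ⊥) (hS : ¬ Group.IsSolvable G)
    (q : G →* Q) {x y : G} (h : Gen x y) (hx : q x = 1)
    (hy1 : q y ≠ 1) (hy : q y ^ 2 = 1) (hN : Nat.card (XX G) ≤ 5) : False := by
  have uniq : ∀ {u v : G}, Gen u v → q u = 1 → ∃ g, cj g x = u ∧ cj g y = v :=
    fun k hu => case_two_unique q ⟨y, hy1⟩ hN h k hx hu
  have dich : ∀ g, q g = 1 ∨ q g = q y := by
    intro g
    have := h.top_le (H := (Subgroup.zpowers (q y)).comap q)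
      (by rw [Subgroup.mem_comap, hx]; exact one_mem _)
      (by rw [Subgroup.mem_comap]; exact Subgroup.mem_zpowers _)
    obtain ⟨k, hk⟩ := this.ge (Subgroup.mem_top g)
    have hk : q y ^ k = q g := hk
    rw [← hk]
    have hy' : q y ^ (2 : ℤ) = 1 := by exact_mod_cast hy
    rcases Int.even_or_odd' k with ⟨n, rfl | rfl⟩
    · left; rw [zpow_mul, hy', one_zpow]
    · right; rw [zpow_add, zpow_mul, hy', one_zpow, one_mul, zpow_one]
  have sq : ∀ g, q g ^ 2 = 1 := by
    intro g
    rcases dich g with e | e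
    · rw [e, one_pow]
    · rw [e, hy]
  have genof : ∀ {c : G}, cj c y = x * y → Gen c y := by
    intro c hc
    refine h.of_mem ?_ (mem_r _ _)
    have : x = c⁻¹ * y * c * y⁻¹ := by
      change x = cj c y * y⁻¹
      rw [hc]; simp
    rw [this]
    exact mul_mem (mul_mem (mul_mem (inv_mem (mem_l _ _)) (mem_r _ _)) (mem_l _ _))
      (inv_mem (mem_r _ _))
  obtain ⟨a, hax, hay⟩ := uniq h.mulr hx
  have hqa : q a ≠ 1 := by
    intro hqa
    obtain ⟨g, h1, h2⟩ := uniq (genof hay) hqa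
    exact hS (chain_solvable h hax hay h1 h2)
  obtain ⟨c, hcx, hcy⟩ := uniq h.mulr.invl (by rw [map_inv, hx, inv_one])
  have hc2 : c * c = 1 := by
    refine h.eq_one hZ ?_ ?_
    · rw [← cj_cj, hcx, cj_inv, hcx, inv_inv]
    · rw [← cj_cj, hcy, cj_mul, hcx, hcy, inv_mul_cancel_left]
  rcases dich c with hqc | hqc
  · obtain ⟨g, h1, h2⟩ := uniq (genof hcy) hqc
    have hx2 : x ^ 2 = 1 := pow_cj (c := c) (by rw [pow_two, hc2]) ⟨g, h1⟩
    have hxi : x⁻¹ = x := by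
      rw [inv_eq_iff_mul_eq_one, ← pow_two, hx2]
    have : a = c := h.eq_of_cj hZ (by rw [hax, hcx, hxi]) (by rw [hay, hcy])
    exact hqa (this ▸ hqc)
  · have hgw : Gen (c * y) y := (genof hcy).mull
    obtain ⟨g, hg, -⟩ := uniq hgw (by rw [map_mul, hqc, ← pow_two, hy])
    have hgz : Gen (x * y * y) y := h.mull.mull
    obtain ⟨k, hk, -⟩ := uniq hgz (by rw [map_mul, map_mul, hx, one_mul, ← pow_two, hy])
    have hw2 : (c * y) ^ 2 = x * y * y := by
      have : c⁻¹ = c := by rw [inv_eq_iff_mul_eq_one, hc2]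
      rw [← hcy, cj, this, pow_two]; group
    have hm : Odd (orderOf x) := by
      rw [← Nat.not_even_iff_odd]
      rintro ⟨m, hm⟩
      have hwm : (c * y) ^ orderOf x = 1 := by
        rw [← hg, ← cj_pow, pow_orderOf_eq_one, cj_id]
      have : x ^ m = 1 := by
        refine pow_cj (c := x * y * y) ?_ ⟨k, hk⟩
        rw [← hw2, ← pow_mul, two_mul, ← hm, hwm]
      have h1 := orderOf_dvd_of_pow_eq_one this
      have h2 := orderOf_pos x
      have h3 := Nat.le_of_dvd (by omega) h1
      omega
    have hpow : ∀ j : ℕ, cj (a ^ j) x = x ∧ cj (a ^ j) y = x ^ j * y := by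
      intro j
      induction j with
      | zero => simp [cj_one]
      | succ j ih =>
        rw [pow_succ, ← cj_cj, ← cj_cj, ih.1, ih.2, cj_mul, cj_pow, hax, hay, pow_succ, mul_assoc]
        exact ⟨rfl, rfl⟩
    have ham : a ^ orderOf x = 1 := by
      refine h.eq_one hZ (hpow _).1 ?_
      rw [(hpow _).2, pow_orderOf_eq_one, one_mul]
    obtain ⟨r, hr⟩ := hm
    have := congrArg q ham
    rw [hr, map_pow, pow_succ, pow_mul, sq, one_pow, one_mul, map_one] at this
    exact hqa this

theorem centreless_case [Finite G] (hZ : Subgroup.center G = ⊥) (hS : ¬ Group.IsSolvable G)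
    {x y : G} (h : Gen x y) (hN : Nat.card (XX G) ≤ 5) : False := by
  let q : G →* Abelianization G := Abelianization.of
  have main : ∀ {x y : G}, Gen x y → q x = 1 → False := by
    intro x y h hx
    by_cases hy : q y ^ 2 = 1
    · by_cases hy1 : q y = 1
      · refine perfect_case ?_ hZ hS h hN
        have := h.top_le (H := q.ker) hx hy1
        rw [← Abelianization.ker_of]
        exact this
      · exact case_two hZ hS q h hx hy1 hy hN
    · exact case_inv q h hx hy hN
  by_cases hx : q x = 1
  · exact main h hx
  by_cases hy : q y = 1
  · exact main h.swap hy
  by_cases hxy : q x = q y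
  · exact main (x := x * y⁻¹) (y := y⁻¹) h.invr.mull (by rw [map_mul, map_inv, hxy, mul_inv_cancel])
  · exact case_generic q h hx hy hxy hN

end nonperfect

end FewGen

namespace FewGen
section centre
variable {G : Type*} [Group G] {C : Type*} [CommGroup C]

theorem retr_card [Finite G] [Finite C] {p : ℕ} (hp : p.Prime) (hC : Nat.card C = p) (ι : C →* G)
    {a b : G} (h : Gen a b) : Nat.card {π : G →* C // ∀ c, π (ι c) = c} ≤ p := by
  have : Fact p.Prime := ⟨hp⟩
  rcases isEmpty_or_nonempty {π : G →* C // ∀ c, π (ι c) = c} with he | ⟨⟨π₀, h₀⟩⟩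
  · simp
  have : Finite (G →* C) := DFunLike.finite _
  obtain ⟨n, hn⟩ := exists_prime_orderOf_dvd_card' (G := C) p (by rw [hC])
  suffices hs : Nat.card {π : G →* C // ∀ c, π (ι c) = c} * p ≤ p * p from
    Nat.le_of_mul_le_mul_right hs hp.pos
  have key : Nat.card ({π : G →* C // ∀ c, π (ι c) = c} × Fin p) ≤ Nat.card (C × C) := by
    refine Nat.card_le_card_of_injective (fun r : {π : G →* C // ∀ c, π (ι c) = c} × Fin p =>
      (r.1.1 a * π₀ a ^ (r.2 : ℕ), r.1.1 b * π₀ b ^ (r.2 : ℕ))) ?_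
    rintro ⟨⟨π, hπ⟩, i⟩ ⟨⟨π', hπ'⟩, j⟩ he
    simp only [Prod.mk.injEq] at he
    have e1 : π * π₀ ^ (i : ℕ) = π' * π₀ ^ (j : ℕ) := by
      refine MonoidHom.eq_of_eqOn_dense h ?_
      rintro z (rfl | hz)
      · exact he.1
      · rw [Set.mem_singleton_iff] at hz
        subst hz
        exact he.2
    have e2 : n ^ (i : ℕ) = n ^ (j : ℕ) := by
      have := DFunLike.congr_fun e1 (ι n)
      simpa [hπ, hπ', h₀] using this
    have e3 : i = j := by
      apply Fin.ext
      exact pow_injOn_Iio_orderOf (by rw [hn]; exact i.2) (by rw [hn]; exact j.2) e2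
    subst e3
    have e4 : π = π' := mul_right_cancel e1
    subst e4
    rfl
  rwa [Nat.card_prod, Nat.card_prod, Nat.card_fin, hC] at key

theorem exists_retr {p : ℕ} (hp : p.Prime) (hC : Nat.card C = p) (ι : C →* G)
    (hι : Function.Injective ι) (hcen : ∀ c g, Commute (ι c) g) {u v : G} (hbad : ¬ Gen u v)
    (htop : ∀ H : Subgroup G, u ∈ H → v ∈ H → ι.range ≤ H → H = ⊤) :
    ∃ π : G →* C, (∀ c, π (ι c) = c) ∧ π u = 1 ∧ π v = 1 := by
  have : Fact p.Prime := ⟨hp⟩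
  let K := Subgroup.closure {u, v}
  have hK : ∀ c, ι c ∈ K → c = 1 := by
    intro c hc
    by_contra hne
    apply hbad
    refine htop K (mem_l _ _) (mem_r _ _) ?_
    rintro _ ⟨d, rfl⟩
    have hd : d ∈ Subgroup.zpowers c := mem_zpowers_of_prime_card hC hne
    obtain ⟨k, rfl⟩ := hd
    change ι (c ^ k) ∈ K
    rw [map_zpow]
    exact zpow_mem hc k
  let f : K × C →* G := MonoidHom.noncommCoprod K.subtype ι (fun k c => (hcen c k).symm)
  have hf : ∀ k c, f (k, c) = (k : G) * ι c := fun k c => rfl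
  have hbij : Function.Bijective f := by
    constructor
    · rw [injective_iff_map_eq_one]
      rintro ⟨k, c⟩ hkc
      rw [hf] at hkc
      have hc : c = 1 := by
        apply hK
        rw [← inv_eq_of_mul_eq_one_right hkc]
        exact inv_mem k.2
      subst hc
      rw [map_one, mul_one] at hkc
      exact Prod.ext (Subtype.ext hkc) rfl
    · rw [← MonoidHom.range_eq_top]
      apply htop
      · exact ⟨(⟨u, mem_l _ _⟩, 1), by rw [hf]; simp⟩
      · exact ⟨(⟨v, mem_r _ _⟩, 1), by rw [hf]; simp⟩
      · rintro _ ⟨c, rfl⟩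
        exact ⟨(1, c), by rw [hf]; simp⟩
  let e : K × C ≃* G := MulEquiv.ofBijective f hbij
  have he : ∀ k c, e (k, c) = (k : G) * ι c := fun k c => rfl
  refine ⟨(MonoidHom.snd K C).comp e.symm.toMonoidHom, ?_, ?_, ?_⟩
  · intro c
    have : e.symm (ι c) = (1, c) := by rw [MulEquiv.symm_apply_eq, he]; simp
    simp [this]
  · have : e.symm u = (⟨u, mem_l _ _⟩, 1) := by rw [MulEquiv.symm_apply_eq, he]; simp
    simp [this]
  · have : e.symm v = (⟨v, mem_r _ _⟩, 1) := by rw [MulEquiv.symm_apply_eq, he]; simp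
    simp [this]

theorem good_card [Finite G] [Finite C] {p : ℕ} (hp : p.Prime) (hC : Nat.card C = p) (ι : C →* G)
    (hι : Function.Injective ι) (hcen : ∀ c g, Commute (ι c) g) {a b : G} (h : Gen a b) {x y : G}
    (htop : ∀ H : Subgroup G, x ∈ H → y ∈ H → ι.range ≤ H → H = ⊤) :
    p ≤ Nat.card {r : C × C // Gen (x * ι r.1) (y * ι r.2)} := by
  classical
  have hfin : Finite (G →* C) := DFunLike.finite _
  have hR := retr_card hp hC ι h
  have hex : ∀ r : {r : C × C // ¬ Gen (x * ι r.1) (y * ι r.2)},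
      ∃ π : G →* C, (∀ c, π (ι c) = c) ∧ π (x * ι r.1.1) = 1 ∧ π (y * ι r.1.2) = 1 := by
    rintro ⟨r, hr⟩
    refine exists_retr hp hC ι hι hcen hr ?_
    intro H h1 h2 h3
    refine htop H ?_ ?_ h3
    · simpa using mul_mem h1 (inv_mem (h3 ⟨r.1, rfl⟩))
    · simpa using mul_mem h2 (inv_mem (h3 ⟨r.2, rfl⟩))
  choose F hF1 hF2 hF3 using hex
  have hB : Nat.card {r : C × C // ¬ Gen (x * ι r.1) (y * ι r.2)} ≤
      Nat.card {π : G →* C // ∀ c, π (ι c) = c} := by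
    refine Nat.card_le_card_of_injective (fun r => ⟨F r, hF1 r⟩) ?_
    intro r s hrs
    have hrs : F r = F s := congrArg Subtype.val hrs
    have a1 := hF2 r
    have a2 := hF2 s
    have b1 := hF3 r
    have b2 := hF3 s
    rw [map_mul, hF1] at a1 a2 b1 b2
    rw [hrs] at a1 b1
    apply Subtype.ext
    apply Prod.ext
    · exact mul_left_cancel (a1.trans a2.symm)
    · exact mul_left_cancel (b1.trans b2.symm)
  have hsum : Nat.card {r : C × C // Gen (x * ι r.1) (y * ι r.2)} +
      Nat.card {r : C × C // ¬ Gen (x * ι r.1) (y * ι r.2)} = p * p := by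
    rw [← Nat.card_sum, Nat.card_congr (Equiv.sumCompl (fun r : C × C => Gen (x * ι r.1) (y * ι r.2))),
      Nat.card_prod, hC]
  have := hp.two_le
  nlinarith

theorem quot_card [Finite G] [Finite C] {p : ℕ} (hp : p.Prime) (hC : Nat.card C = p) (ι : C →* G)
    (hι : Function.Injective ι) (hcen : ∀ c g, Commute (ι c) g) [ι.range.Normal] {a b : G}
    (h : Gen a b) : Nat.card (Epi (G ⧸ ι.range)) * p ≤ Nat.card (Epi G) := by
  classical
  have hemb : ∀ e : Epi (G ⧸ ι.range), ∃ f : Fin p → {r : C × C //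
      Gen (e.1.1.out * ι r.1) (e.1.2.out * ι r.2)}, Function.Injective f := by
    intro e
    have hg := good_card hp hC ι hι hcen h (x := e.1.1.out) (y := e.1.2.out) (by
      intro H h1 h2 h3
      have ht : H.map (QuotientGroup.mk' ι.range) = ⊤ := by
        apply e.2.top_le
        · exact ⟨_, h1, QuotientGroup.out_eq' _⟩
        · exact ⟨_, h2, QuotientGroup.out_eq' _⟩
      rw [eq_top_iff]
      intro g _
      obtain ⟨k, hk, hkg⟩ := ht.ge (Subgroup.mem_top (QuotientGroup.mk' ι.range g))
      have := QuotientGroup.eq.1 hkg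
      simpa using mul_mem hk (h3 this))
    have := Fintype.ofFinite {r : C × C // Gen (e.1.1.out * ι r.1) (e.1.2.out * ι r.2)}
    rw [Nat.card_eq_fintype_card] at hg
    obtain ⟨f⟩ := Function.Embedding.nonempty_of_card_le (α := Fin p)
      (β := {r : C × C // Gen (e.1.1.out * ι r.1) (e.1.2.out * ι r.2)}) (by simpa using hg)
    exact ⟨f, f.injective⟩
  choose f hf using hemb
  have key : Nat.card (Epi (G ⧸ ι.range) × Fin p) ≤ Nat.card (Epi G) := by
    refine Nat.card_le_card_of_injective (fun r => (⟨(r.1.1.1.out * ι (f r.1 r.2).1.1,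
      r.1.1.2.out * ι (f r.1 r.2).1.2), (f r.1 r.2).2⟩ : Epi G)) ?_
    rintro ⟨e, i⟩ ⟨e', j⟩ he
    simp only [Subtype.mk.injEq, Prod.mk.injEq] at he
    have hm : ∀ (X : G ⧸ ι.range) (c : C), ((X.out * ι c : G) : G ⧸ ι.range) = X := by
      intro X c
      have : ((ι c : G) : G ⧸ ι.range) = 1 := (QuotientGroup.eq_one_iff _).2 ⟨c, rfl⟩
      rw [QuotientGroup.mk_mul, this, mul_one, QuotientGroup.out_eq']
    have hee : e = e' := by
      apply Subtype.ext
      apply Prod.ext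
      · have := congrArg (fun g : G => (g : G ⧸ ι.range)) he.1
        simpa only [hm] using this
      · have := congrArg (fun g : G => (g : G ⧸ ι.range)) he.2
        simpa only [hm] using this
    subst hee
    have : f e i = f e j := by
      apply Subtype.ext
      apply Prod.ext
      · exact hι (mul_left_cancel he.1)
      · exact hι (mul_left_cancel he.2)
    rw [hf e this]
  rwa [Nat.card_prod, Nat.card_fin] at key

end centre

universe u

theorem main_aux (n : ℕ) : ∀ (G : Type u) [Group G] [Finite G], Nat.card G = n →
    (∃ a b : G, Gen a b) → Nat.card (Epi G) < 6 * Nat.card G → Group.IsSolvable G := by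
  induction n using Nat.strong_induction_on with
  | _ n ih =>
    intro G _ _ hn hgen hcard
    obtain ⟨a, b, hab⟩ := hgen
    by_cases hZ : Subgroup.center G = ⊥
    · by_contra hS
      refine centreless_case hZ hS hab ?_
      have := (card_XX hZ).trans_lt hcard
      have := Nat.lt_of_mul_lt_mul_right this
      omega
    · have hne : Nat.card (Subgroup.center G) ≠ 1 := by
        rwa [ne_eq, Subgroup.card_eq_one]
      obtain ⟨p, hp, hdvd⟩ := Nat.exists_prime_and_dvd hne
      have : Fact p.Prime := ⟨hp⟩
      obtain ⟨z, hz⟩ := exists_prime_orderOf_dvd_card' p hdvd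
      let _ : CommGroup (Subgroup.zpowers z) :=
        { (inferInstance : Group (Subgroup.zpowers z)) with
          mul_comm := fun s t => Subtype.ext (Subtype.ext
            ((Subgroup.mem_center_iff.1 t.1.2) s.1.1)) }
      let ι : Subgroup.zpowers z →* G :=
        (Subgroup.center G).subtype.comp (Subgroup.zpowers z).subtype
      have hC : Nat.card (Subgroup.zpowers z) = p := by rw [Nat.card_zpowers, hz]
      have hι : Function.Injective ι :=
        Subtype.val_injective.comp Subtype.val_injective
      have hcen : ∀ c g, Commute (ι c) g := fun c g =>
        ((Subgroup.mem_center_iff.1 c.1.2) g).symm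
      have hnorm : ι.range.Normal := by
        constructor
        rintro _ ⟨c, rfl⟩ g
        refine ⟨c, ?_⟩
        rw [← (hcen c g).eq, mul_inv_cancel_right]
      have hq := quot_card hp hC ι hι hcen hab
      have hR : Nat.card ι.range = p := by
        rw [← hC]; exact (Nat.card_congr (MonoidHom.ofInjective hι).toEquiv).symm
      have hG : Nat.card G = Nat.card (G ⧸ ι.range) * p := by
        rw [Subgroup.card_eq_card_quotient_mul_card_subgroup ι.range, hR]
      have hpos : 0 < Nat.card (G ⧸ ι.range) := Nat.card_pos
      have hsol : Group.IsSolvable (G ⧸ ι.range) := by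
        refine ih (Nat.card (G ⧸ ι.range)) ?_ _ rfl ?_ ?_
        · have := hp.two_le
          rw [← hn, hG]; nlinarith
        · refine ⟨QuotientGroup.mk' _ a, QuotientGroup.mk' _ b, ?_⟩
          have := congrArg (Subgroup.map (QuotientGroup.mk' ι.range)) hab
          rw [MonoidHom.map_closure, Set.image_pair,
            Subgroup.map_top_of_surjective _ (QuotientGroup.mk'_surjective _)] at this
          exact this
        · have := hq.trans_lt hcard
          rw [hG, ← mul_assoc] at this
          exact Nat.lt_of_mul_lt_mul_right this
      exact Group.isSolvable_of_ker_le_range ι (QuotientGroup.mk' ι.range)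
        (by rw [QuotientGroup.ker_mk'])

end FewGen

/-- Let `G` be a finite 2-generated group. If the number of ordered pairs
`(x, y) ∈ G × G` with `⟨x, y⟩ = G` is strictly less than `6·|G|`, then `G` is soluble. -/
theorem stmt_8 {G : Type*} [Group G] [Finite G]
    (h2gen : ∃ a b : G, Subgroup.closure {a, b} = ⊤)
    (h : Nat.card {p : G × G | Subgroup.closure {p.1, p.2} = ⊤} < 6 * Nat.card G) :
    IsSolvable G := by
  exact FewGen.main_aux _ G rfl h2gen h
end
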